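/- Let Σ_g be a closed oriented surface of genus g ≥ 1. Then TC((Σ_g × S²) # (Σ_g × S²)) ≤ 7. -/

import Mathlib

/-!
Common definitions: rational singular (co)homology, homotopy groups and asphericity,
classifying maps, closed oriented manifolds, connected sums, wedges, topological
complexity, sectional category weights, and (a)toroidal classes.
-/

open CategoryTheory unitInterval Topology

noncomputable section

/-- The singular chain complex with rational coefficients. -/
def singularChainComplex : TopCat.{0} ⥤ ChainComplex (ModuleCat.{0} ℚ) ℕ :=
  TopCat.toSSet ⋙ ((SimplicialObject.whiskering _ _).obj (ModuleCat.free ℚ)) ⋙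
    AlgebraicTopology.alternatingFaceMapComplex (ModuleCat ℚ)

/-- The `k`-th singular homology functor with rational coefficients. -/
def singularHomologyFunctor (k : ℕ) : TopCat.{0} ⥤ ModuleCat.{0} ℚ :=
  singularChainComplex ⋙ HomologicalComplex.homologyFunctor (ModuleCat ℚ) (ComplexShape.down ℕ) k

/-- `H k X` is the `k`-th rational singular homology group `H_k(X; ℚ)`. -/
abbrev H (k : ℕ) (X : Type) [TopologicalSpace X] : Type :=
  (singularHomologyFunctor k).obj (TopCat.of X)

/-- The map `H_k(f; ℚ)` induced on rational singular homology by a continuous map `f`. -/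
def Hmap (k : ℕ) {X Y : Type} [TopologicalSpace X] [TopologicalSpace Y] (f : C(X, Y)) :
    H k X →ₗ[ℚ] H k Y :=
  ((singularHomologyFunctor k).map (TopCat.ofHom f : TopCat.of X ⟶ TopCat.of Y)).hom

/-- `Hco k X` is the `k`-th rational singular cohomology group `H^k(X; ℚ)`; over the
field `ℚ`, universal coefficients identify it naturally with the dual of homology. -/
abbrev Hco (k : ℕ) (X : Type) [TopologicalSpace X] : Type :=
  Module.Dual ℚ (H k X)

/-- The map `H^k(f; ℚ)` induced on rational singular cohomology (the Kronecker-dual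
of the map induced on homology). -/
def Hcomap (k : ℕ) {X Y : Type} [TopologicalSpace X] [TopologicalSpace Y] (f : C(X, Y)) :
    Hco k Y →ₗ[ℚ] Hco k X :=
  (Hmap k f).dualMap

/-- Transport of a cohomology class along an equality of degrees. -/
def coCast {X : Type} [TopologicalSpace X] {p q : ℕ} (h : p = q) :
    Hco p X →ₗ[ℚ] Hco q X := by
  subst h; exact LinearMap.id

/-- A non-zero element spanning a rational vector space (necessarily one-dimensional);
this characterises fundamental classes in the top (co)homology of closed connected
oriented manifolds with rational coefficients. -/
def IsGenerator {W : Type} [AddCommGroup W] [Module ℚ W] (w : W) : Prop :=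
  w ≠ 0 ∧ ∀ v : W, ∃ c : ℚ, v = c • w

/-- `π₂(X) = 0`. -/
def Pi2Trivial (X : Type) [TopologicalSpace X] : Prop :=
  ∀ x : X, Subsingleton (HomotopyGroup (Fin 2) X x)

/-- A space is aspherical iff all its homotopy groups in degrees `≥ 2` vanish
(for manifolds this is equivalent to contractibility of the universal cover). -/
def Aspherical (X : Type) [TopologicalSpace X] : Prop :=
  ∀ k : ℕ, 2 ≤ k → ∀ x : X, Subsingleton (HomotopyGroup (Fin k) X x)

/-- A continuous map, regarded as a morphism in `TopCat`. -/
def toTopHom {X Y : Type} [TopologicalSpace X] [TopologicalSpace Y] (f : C(X, Y)) :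
    TopCat.of X ⟶ TopCat.of Y := TopCat.ofHom f

/-- The homomorphism induced by a continuous map on fundamental groups. -/
def π₁map {X Y : Type} [TopologicalSpace X] [TopologicalSpace Y] (f : C(X, Y)) (x : X) :
    FundamentalGroup X x →* FundamentalGroup Y (f x) :=
  Functor.mapEnd (X := FundamentalGroupoid.mk x)
    (show FundamentalGroupoid X ⥤ FundamentalGroupoid Y from
      FundamentalGroupoid.fundamentalGroupoidFunctor.map (toTopHom f))

/-- `B` is a model for an Eilenberg–MacLane space `K(G, 1)`:  it is path-connected and
all its higher homotopy groups vanish. -/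
def IsAsphericalSpace (B : Type) [TopologicalSpace B] : Prop :=
  PathConnectedSpace B ∧ Aspherical B

/-- `c : M → B` is a classifying map for `M`, i.e. `B` is a model for `Bπ₁(M)`
(path-connected with vanishing higher homotopy groups) and `c` induces an isomorphism
on fundamental groups. -/
def IsClassifyingMap {M B : Type} [TopologicalSpace M] [TopologicalSpace B]
    (c : C(M, B)) : Prop :=
  IsAsphericalSpace B ∧ ∀ x : M, Function.Bijective (π₁map c x)

/-- Every point has a neighbourhood homeomorphic to `ℝⁿ`. -/
def IsLocallyEuclidean (n : ℕ) (M : Type) [TopologicalSpace M] : Prop :=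
  ∀ x : M, ∃ U : Set M, x ∈ U ∧ IsOpen U ∧ Nonempty (U ≃ₜ EuclideanSpace ℝ (Fin n))

/-- A closed connected oriented topological `n`-manifold.  (For a closed connected
`n`-manifold, orientability is equivalent to `H_n(M; ℚ) ≠ 0`.) -/
def IsClosedOrientedManifold (n : ℕ) (M : Type) [TopologicalSpace M] : Prop :=
  CompactSpace M ∧ T2Space M ∧ SecondCountableTopology M ∧ ConnectedSpace M ∧
    IsLocallyEuclidean n M ∧ Nontrivial (H n M)

/-- Data exhibiting `N` as a connected sum `M₁ # M₂` of `n`-manifolds:  `N` is covered by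
two closed pieces `C₁`, `C₂`, homeomorphic to `M₁` resp. `M₂` with an embedded open ball
removed, which overlap exactly along the boundary spheres.  (Gluing along any
homeomorphism of the sphere yields a space homeomorphic to the connected sum.) -/
structure ConnectedSumData (n : ℕ) (N M₁ M₂ : Type) [TopologicalSpace N]
    [TopologicalSpace M₁] [TopologicalSpace M₂] where
  φ₁ : EuclideanSpace ℝ (Fin n) → M₁
  φ₂ : EuclideanSpace ℝ (Fin n) → M₂
  emb₁ : IsOpenEmbedding φ₁
  emb₂ : IsOpenEmbedding φ₂
  C₁ : Set N
  C₂ : Set N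
  closed₁ : IsClosed C₁
  closed₂ : IsClosed C₂
  cover : C₁ ∪ C₂ = Set.univ
  h₁ : C₁ ≃ₜ ((φ₁ '' Metric.ball 0 1)ᶜ : Set M₁)
  h₂ : C₂ ≃ₜ ((φ₂ '' Metric.ball 0 1)ᶜ : Set M₂)
  inter₁ : ∀ x : C₁, (x : N) ∈ C₂ ↔ ((h₁ x : M₁) ∈ φ₁ '' Metric.sphere 0 1)
  inter₂ : ∀ x : C₂, (x : N) ∈ C₁ ↔ ((h₂ x : M₂) ∈ φ₂ '' Metric.sphere 0 1)

/-- `N` is a connected sum of `M₁` and `M₂` (as `n`-manifolds). -/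
def IsConnectedSum (n : ℕ) (N M₁ M₂ : Type) [TopologicalSpace N]
    [TopologicalSpace M₁] [TopologicalSpace M₂] : Prop :=
  Nonempty (ConnectedSumData n N M₁ M₂)

/-- The degree-one pinch map `N = M₁ # M₂ → M₁`:  it restricts to the canonical
identification on the `M₁`-piece and sends the `M₂`-piece into the closed ball. -/
def ConnectedSumData.IsPinchFst {n : ℕ} {N M₁ M₂ : Type} [TopologicalSpace N]
    [TopologicalSpace M₁] [TopologicalSpace M₂] (D : ConnectedSumData n N M₁ M₂)
    (p : C(N, M₁)) : Prop :=
  (∀ x : D.C₁, p (x : N) = (D.h₁ x : M₁)) ∧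
    ∀ x : D.C₂, p (x : N) ∈ D.φ₁ '' Metric.closedBall 0 1

/-- The degree-one pinch map `N = M₁ # M₂ → M₂`. -/
def ConnectedSumData.IsPinchSnd {n : ℕ} {N M₁ M₂ : Type} [TopologicalSpace N]
    [TopologicalSpace M₁] [TopologicalSpace M₂] (D : ConnectedSumData n N M₁ M₂)
    (p : C(N, M₂)) : Prop :=
  (∀ x : D.C₂, p (x : N) = (D.h₂ x : M₂)) ∧
    ∀ x : D.C₁, p (x : N) ∈ D.φ₂ '' Metric.closedBall 0 1

/-- `N` is an iterated connected sum `M 0 # M 1 # ⋯ # M (m-1)` of `n`-manifolds. -/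
def IsIteratedConnectedSum (n : ℕ) (N : Type) [TopologicalSpace N] :
    (m : ℕ) → (Fin m → TopCat.{0}) → Prop
  | 0, _ => False
  | 1, M => Nonempty (N ≃ₜ (M 0))
  | (m + 2), M =>
      ∃ P : TopCat.{0}, IsIteratedConnectedSum n P (m + 1) (fun i => M i.castSucc) ∧
        IsConnectedSum n N P (M (Fin.last (m + 1)))

/-- `W` is the wedge (one-point union) of the pointed spaces `(M₁, x₁)` and `(M₂, x₂)`. -/
def IsWedge (W M₁ M₂ : Type) [TopologicalSpace W] [TopologicalSpace M₁]
    [TopologicalSpace M₂] (x₁ : M₁) (x₂ : M₂) : Prop :=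
  ∃ (j₁ : C(M₁, W)) (j₂ : C(M₂, W)), IsClosedEmbedding j₁ ∧ IsClosedEmbedding j₂ ∧
    Set.range j₁ ∪ Set.range j₂ = Set.univ ∧
    Set.range j₁ ∩ Set.range j₂ = {j₁ x₁} ∧ j₁ x₁ = j₂ x₂

/-- `X × X` admits a cover by `m` open sets over each of which there is a continuous
motion planning rule (a continuous local section of the free path fibration). -/
def TCCoverable (X : Type) [TopologicalSpace X] (m : ℕ) : Prop :=
  ∃ U : Fin m → Set (X × X), (∀ i, IsOpen (U i)) ∧ (⋃ i, U i) = Set.univ ∧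
    ∀ i, ∃ s : C(U i, C(I, X)),
      ∀ p : U i, (s p) 0 = (p : X × X).1 ∧ (s p) 1 = (p : X × X).2

/-- The (unreduced) topological complexity of `X`:  the smallest number of open sets in a
cover of `X × X` admitting continuous motion planning rules (`⊤` if there is none). -/
def topologicalComplexity (X : Type) [TopologicalSpace X] : ℕ∞ :=
  sInf {c : ℕ∞ | ∃ m : ℕ, c = m ∧ TCCoverable X m}

/-- The free path fibration `X^{[0,1]} → X × X`, `γ ↦ (γ(0), γ(1))`. -/
def pathFibration (X : Type) [TopologicalSpace X] : C(C(I, X), X × X) :=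
  ⟨fun γ => (γ 0, γ 1), (continuous_eval_const 0).prodMk (continuous_eval_const 1)⟩

/-- The Schwarz genus (sectional category) of the pullback of `p` along `f` is at most
`k`:  `Y` is covered by `k` open sets over each of which `f` lifts continuously
through `p`. -/
def GenusPullbackLE {E B : Type} [TopologicalSpace E] [TopologicalSpace B] (p : C(E, B))
    {Y : Type} [TopologicalSpace Y] (f : C(Y, B)) (k : ℕ) : Prop :=
  ∃ U : Fin k → Set Y, (∀ i, IsOpen (U i)) ∧ (⋃ i, U i) = Set.univ ∧
    ∀ i, ∃ s : C(U i, E), ∀ y : U i, p (s y) = f (y : Y)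

/-- The sectional category weight of a cohomology class `u` on the base of `p`:  the
supremum of those `m` such that `u` pulls back to zero along every map `f` for which
the pullback of `p` along `f` has Schwarz genus at most `m`. -/
def secatWeight {E B : Type} [TopologicalSpace E] [TopologicalSpace B] (p : C(E, B))
    {k : ℕ} (u : Hco k B) : ℕ∞ :=
  sSup {w : ℕ∞ | ∃ m : ℕ, w = m ∧ ∀ (Y : Type) [TopologicalSpace Y] (f : C(Y, B)),
    GenusPullbackLE p f m → Hcomap k f u = 0}

/-- The topological complexity weight:  sectional category weight with respect to the
free path fibration. -/
def tcWeight {X : Type} [TopologicalSpace X] {k : ℕ} (u : Hco k (X × X)) : ℕ∞ :=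
  secatWeight (pathFibration X) u

/-- The `n`-dimensional sphere. -/
abbrev unitSphere (n : ℕ) : Type :=
  ↥(Metric.sphere (0 : EuclideanSpace ℝ (Fin (n + 1))) 1)

/-- The 2-torus `T² = S¹ × S¹`. -/
abbrev Torus2 : Type := unitSphere 1 × unitSphere 1

/-- A degree-two rational homology class `v` is toroidal (relative to a fundamental class
`ωT` of the torus) if some map from the torus realises a non-zero multiple of `v`. -/
def IsToroidal {X : Type} [TopologicalSpace X] (ωT : H 2 Torus2) (v : H 2 X) : Prop :=
  ∃ (f : C(Torus2, X)) (α : ℚ), α ≠ 0 ∧ Hmap 2 f ωT = α • v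

/-- A non-zero degree-two rational homology class is atoroidal if it is not toroidal. -/
def IsAtoroidal {X : Type} [TopologicalSpace X] (ωT : H 2 Torus2) (v : H 2 X) : Prop :=
  v ≠ 0 ∧ ¬ IsToroidal ωT v

/-- A degree-two rational cohomology class `u` is toroidal if it pulls back non-trivially
under some map from the torus. -/
def IsCoToroidal {X : Type} [TopologicalSpace X] (u : Hco 2 X) : Prop :=
  ∃ f : C(Torus2, X), Hcomap 2 f u ≠ 0

/-- A non-zero degree-two rational cohomology class is atoroidal if it pulls back to zero
under every map from the torus. -/
def IsCoAtoroidal {X : Type} [TopologicalSpace X] (u : Hco 2 X) : Prop :=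
  u ≠ 0 ∧ ∀ f : C(Torus2, X), Hcomap 2 f u = 0


section Categorical

variable {X Y Z W : Type*} [TopologicalSpace X] [TopologicalSpace Y] [TopologicalSpace Z]
  [TopologicalSpace W]

/-- A map is locally nullhomotopic if it is homotopic to a locally constant map. -/
def LocallyNullhomotopic (f : C(X, Y)) : Prop :=
  ∃ g : C(X, Y), IsLocallyConstant g ∧ f.Homotopic g

namespace LocallyNullhomotopic

theorem comp_right {f : C(Y, Z)} (hf : LocallyNullhomotopic f) (h : C(X, Y)) :
    LocallyNullhomotopic (f.comp h) := by
  obtain ⟨g, hg, hfg⟩ := hf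
  exact ⟨g.comp h, hg.comp_continuous h.continuous, hfg.comp (.refl h)⟩

theorem comp_left {f : C(X, Y)} (hf : LocallyNullhomotopic f) (k : C(Y, Z)) :
    LocallyNullhomotopic (k.comp f) := by
  obtain ⟨g, hg, hfg⟩ := hf
  exact ⟨k.comp g, hg.comp k, .comp (.refl k) hfg⟩

theorem of_homotopic {f f' : C(X, Y)} (hf : LocallyNullhomotopic f) (h : f'.Homotopic f) :
    LocallyNullhomotopic f' := by
  obtain ⟨g, hg, hfg⟩ := hf
  exact ⟨g, hg, h.trans hfg⟩

theorem of_nullhomotopic {f : C(X, Y)} (hf : f.Nullhomotopic) : LocallyNullhomotopic f := by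
  obtain ⟨y, hy⟩ := hf
  exact ⟨.const _ y, IsLocallyConstant.const y, hy⟩

theorem of_factor [ContractibleSpace Y] (k : C(Y, Z)) (h : C(X, Y)) :
    LocallyNullhomotopic (k.comp h) :=
  of_nullhomotopic (((id_nullhomotopic Y).comp_left h).comp_right k)

theorem prodMap {f : C(X, Y)} {g : C(Z, W)} (hf : LocallyNullhomotopic f)
    (hg : LocallyNullhomotopic g) : LocallyNullhomotopic (f.prodMap g) := by
  obtain ⟨f', hf', hff'⟩ := hf
  obtain ⟨g', hg', hgg'⟩ := hg
  exact ⟨f'.prodMap g', (hf'.comp_continuous continuous_fst).prodMk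
    (hg'.comp_continuous continuous_snd), hff'.prodMap hgg'⟩

theorem of_fibers {ι : Type*} {f : C(X, Y)} {i : X → ι} (hi : IsLocallyConstant i)
    (h : ∀ k, LocallyNullhomotopic (f.restrict (i ⁻¹' {k}))) : LocallyNullhomotopic f := by
  choose g hg hfg using h
  let F := fun k => (hfg k).some
  have hF : Continuous fun q : I × X => F (i q.2) (q.1, ⟨q.2, rfl⟩) := by
    rw [continuous_iff_continuousAt]
    rintro ⟨t, x⟩
    have ho : IsOpen {q : I × X | i q.2 = i x} :=
      (hi.isOpen_fiber (i x)).preimage continuous_snd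
    refine ContinuousOn.continuousAt (s := {q : I × X | i q.2 = i x}) ?_ (ho.mem_nhds rfl)
    rw [continuousOn_iff_continuous_domRestrict]
    have hc : Continuous fun q : {q : I × X | i q.2 = i x} =>
        F (i x) (q.1.1, ⟨q.1.2, q.2⟩) := by
      fun_prop
    convert hc using 1
    funext q
    obtain ⟨⟨s, y⟩, hy⟩ := q
    have hy' : i y = i x := hy
    simp only [Set.domRestrict_apply]
    have key : ∀ k (hk : i y = k), F (i y) (s, ⟨y, rfl⟩) = F k (s, ⟨y, hk⟩) := by
      rintro k rfl; rfl
    exact key _ hy'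
  refine ⟨⟨fun x => F (i x) (1, ⟨x, rfl⟩), hF.comp (by fun_prop : Continuous fun x : X =>
    ((1 : I), x))⟩, ?_, ⟨⟨⟨_, hF⟩, ?_, ?_⟩⟩⟩
  · rw [IsLocallyConstant.iff_eventually_eq]
    intro x
    have h1 := (hg (i x)).eventually_eq ⟨x, rfl⟩
    have ho : IsOpen (i ⁻¹' {i x}) := hi.isOpen_fiber (i x)
    rw [nhds_subtype, Filter.eventually_comap] at h1
    filter_upwards [h1, ho.mem_nhds rfl] with y hy hyx
    have := hy ⟨y, hyx⟩ rfl
    have key : ∀ {y} k (hk : i y = k), F (i y) (1, ⟨y, rfl⟩) = g k ⟨y, hk⟩ := by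
      rintro y k rfl; simp
    exact (key _ hyx).trans (this.trans (key _ rfl).symm)
  · intro x; simp
  · intro x; rfl

end LocallyNullhomotopic

/-- A set is categorical for `f` if `f` is locally nullhomotopic on an open neighbourhood. -/
def IsCategorical (f : C(X, Y)) (A : Set X) : Prop :=
  ∃ U : Set X, IsOpen U ∧ A ⊆ U ∧ LocallyNullhomotopic (f.restrict U)

namespace IsCategorical

theorem mono {f : C(X, Y)} {A B : Set X} (h : IsCategorical f B) (hAB : A ⊆ B) :
    IsCategorical f A := by
  obtain ⟨U, hU, hBU, hf⟩ := h
  exact ⟨U, hU, hAB.trans hBU, hf⟩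

theorem restrict_mono {f : C(X, Y)} {A B : Set X} (hAB : A ⊆ B)
    (h : LocallyNullhomotopic (f.restrict B)) : LocallyNullhomotopic (f.restrict A) :=
  h.comp_right ⟨Set.inclusion hAB, continuous_inclusion hAB⟩

theorem comp_left {f : C(X, Y)} {A : Set X} (h : IsCategorical f A) (k : C(Y, Z)) :
    IsCategorical (k.comp f) A := by
  obtain ⟨U, hU, hBU, hf⟩ := h
  exact ⟨U, hU, hBU, hf.comp_left k⟩

theorem comp_right {f : C(Y, Z)} {A : Set Y} (h : IsCategorical f A) (k : C(X, Y)) :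
    IsCategorical (f.comp k) (k ⁻¹' A) := by
  obtain ⟨U, hU, hBU, hf⟩ := h
  refine ⟨k ⁻¹' U, hU.preimage k.continuous, Set.preimage_mono hBU, ?_⟩
  exact hf.comp_right ⟨fun x : ↥(k ⁻¹' U) => ⟨k x.1, x.2⟩, by fun_prop⟩

theorem of_homotopic {f f' : C(X, Y)} {A : Set X} (h : IsCategorical f A)
    (hff' : f'.Homotopic f) : IsCategorical f' A := by
  obtain ⟨U, hU, hBU, hf⟩ := h
  exact ⟨U, hU, hBU, hf.of_homotopic
    (hff'.comp (.refl (⟨Subtype.val, continuous_subtype_val⟩ : C(U, X))))⟩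

theorem image {f : C(Y, Z)} {j : C(X, Y)} (hj : IsOpenEmbedding j) {A : Set X}
    (h : IsCategorical (f.comp j) A) : IsCategorical f (j '' A) := by
  obtain ⟨U, hU, hBU, hf⟩ := h
  refine ⟨j '' U, hj.isOpenMap U hU, Set.image_mono hBU, ?_⟩
  let e := hj.toIsEmbedding.homeomorphImage U
  have : f.restrict (j '' U) = ((f.comp j).restrict U).comp
      ⟨e.symm, e.symm.continuous⟩ := by
    ext y
    have : (j (e.symm y) : Y) = y := congrArg Subtype.val (e.apply_symm_apply y)
    simp [this]
  rw [this]
  exact hf.comp_right _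

theorem prodMap {f : C(X, Y)} {g : C(Z, W)} {A : Set X} {B : Set Z} (hf : IsCategorical f A)
    (hg : IsCategorical g B) : IsCategorical (f.prodMap g) (A ×ˢ B) := by
  obtain ⟨U, hU, hAU, hf⟩ := hf
  obtain ⟨V, hV, hBV, hg⟩ := hg
  refine ⟨U ×ˢ V, hU.prod hV, Set.prod_mono hAU hBV, ?_⟩
  exact (hf.prodMap hg).comp_right
    ⟨fun p : ↥(U ×ˢ V) => (⟨p.1.1, p.2.1⟩, ⟨p.1.2, p.2.2⟩), by fun_prop⟩

/-- A family of categorical sets lying in disjoint open sets has categorical union. -/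
theorem iUnion {ι : Type*} {f : C(X, Y)} {A O : ι → Set X} (hO : ∀ i, IsOpen (O i))
    (hAO : ∀ i, A i ⊆ O i) (hd : Pairwise (Function.onFun Disjoint O))
    (h : ∀ i, IsCategorical f (A i)) : IsCategorical f (⋃ i, A i) := by
  choose U hU hAU hf using h
  refine ⟨⋃ i, U i ∩ O i, isOpen_iUnion fun i => (hU i).inter (hO i),
    Set.iUnion_mono fun i => Set.subset_inter (hAU i) (hAO i), ?_⟩
  have hx : ∀ x : ⋃ i, U i ∩ O i, ∃ i, (x : X) ∈ U i ∩ O i := fun x => Set.mem_iUnion.1 x.2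
  choose i hi using hx
  have huniq : ∀ (x : ⋃ i, U i ∩ O i) k, (x : X) ∈ O k → i x = k := by
    intro x k hk
    by_contra hne
    exact Set.disjoint_left.1 (hd hne) (hi x).2 hk
  have hlc : IsLocallyConstant i := by
    rw [IsLocallyConstant.iff_eventually_eq]
    intro x
    filter_upwards [((hO (i x)).preimage continuous_subtype_val).mem_nhds (hi x).2] with y hy
    exact huniq y _ hy
  refine LocallyNullhomotopic.of_fibers hlc fun k => ?_
  exact (hf k).comp_right ⟨fun x : ↥(i ⁻¹' {k}) => ⟨x.1.1, by
    have := hi x.1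
    rw [show i x.1 = k from x.2] at this
    exact this.1⟩, by fun_prop⟩

theorem union {f : C(X, Y)} {A B O O' : Set X} (hA : IsCategorical f A)
    (hB : IsCategorical f B) (hO : IsOpen O) (hO' : IsOpen O') (hAO : A ⊆ O) (hBO : B ⊆ O')
    (hd : Disjoint O O') : IsCategorical f (A ∪ B) := by
  rw [Set.union_eq_iUnion]
  refine iUnion (O := fun b => cond b O O') ?_ ?_ ?_ ?_
  · rintro (_ | _) <;> assumption
  · rintro (_ | _) <;> assumption
  · rintro (_ | _) (_ | _) h
    · exact absurd rfl h
    · exact hd.symm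
    · exact hd
    · exact absurd rfl h
  · rintro (_ | _) <;> assumption

theorem union_of_separated [CompletelyNormalSpace X] {f : C(X, Y)} {A B : Set X}
    (hA : IsCategorical f A) (hB : IsCategorical f B) (h₁ : Disjoint (closure A) B)
    (h₂ : Disjoint A (closure B)) : IsCategorical f (A ∪ B) := by
  obtain ⟨O, O', hO, hO', hAO, hBO, hd⟩ :=
    separatedNhds_iff_disjoint.2 (CompletelyNormalSpace.completely_normal h₁ h₂)
  exact hA.union hB hO hO' hAO hBO hd

theorem empty (f : C(X, Y)) : IsCategorical f ∅ := by
  refine ⟨∅, isOpen_empty, le_rfl, f.restrict ∅, ?_, .refl _⟩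
  rw [IsLocallyConstant.iff_eventually_eq]
  exact fun x => x.2.elim

theorem biUnion_of_separated [CompletelyNormalSpace X] {ι : Type*} {f : C(X, Y)}
    (s : Finset ι) {A : ι → Set X} (hA : ∀ i ∈ s, IsCategorical f (A i))
    (h : ∀ i ∈ s, ∀ j ∈ s, i ≠ j → Disjoint (closure (A i)) (A j)) :
    IsCategorical f (⋃ i ∈ s, A i) := by
  classical
  induction s using Finset.induction_on with
  | empty => simpa using empty f
  | insert a s ha ih =>
    rw [Finset.set_biUnion_insert]
    refine union_of_separated (hA a (by simp))
      (ih (fun i hi => hA i (by simp [hi])) fun i hi j hj => h i (by simp [hi]) j (by simp [hj]))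
      ?_ ?_
    · simp only [Set.disjoint_iUnion_right]
      intro j hj
      exact h a (by simp) j (by simp [hj]) (by rintro rfl; exact ha hj)
    · rw [s.closure_biUnion]
      simp only [Set.disjoint_iUnion_right]
      intro j hj
      exact (h j (by simp [hj]) a (by simp) (by rintro rfl; exact ha hj)).symm

end IsCategorical
end Categorical

section ZeroDimensional

variable {X Y : Type*} [TopologicalSpace X] [TopologicalSpace Y]

/-- A set is zero-dimensional if every open cover of a subset has a disjoint open refinement
still covering the subset. -/
def IsZeroDimensional (A : Set X) : Prop :=
  ∀ B ⊆ A, ∀ 𝒰 : Set (Set X), (∀ U ∈ 𝒰, IsOpen U) → B ⊆ ⋃₀ 𝒰 →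
    ∃ 𝒱 : Set (Set X), (∀ V ∈ 𝒱, IsOpen V) ∧ 𝒱.PairwiseDisjoint id ∧
      (∀ V ∈ 𝒱, ∃ U ∈ 𝒰, V ⊆ U) ∧ B ⊆ ⋃₀ 𝒱

namespace IsZeroDimensional

theorem mono {A B : Set X} (hA : IsZeroDimensional A) (h : B ⊆ A) : IsZeroDimensional B :=
  fun C hC => hA C (hC.trans h)

theorem of_basis [SecondCountableTopology X] {A : Set X}
    (h : ∀ x ∈ A, ∀ U, IsOpen U → x ∈ U → ∃ V, IsOpen V ∧ x ∈ V ∧ V ⊆ U ∧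
      Disjoint (closure V ∩ A) Vᶜ) : IsZeroDimensional A := by
  intro B hBA 𝒰 h𝒰 hB
  have hx : ∀ x : B, ∃ V, IsOpen V ∧ (x : X) ∈ V ∧ (∃ U ∈ 𝒰, V ⊆ U) ∧
      Disjoint (closure V ∩ A) Vᶜ := by
    intro x
    obtain ⟨U, hU, hxU⟩ := hB x.2
    obtain ⟨V, hV, hxV, hVU, hd⟩ := h x (hBA x.2) U (h𝒰 U hU) hxU
    exact ⟨V, hV, hxV, ⟨U, hU, hVU⟩, hd⟩
  choose V hV hxV hVU hd using hx
  obtain ⟨T, hT, hTU⟩ := TopologicalSpace.isOpen_iUnion_countable V hV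
  rcases T.eq_empty_or_nonempty with rfl | hTne
  · refine ⟨∅, by simp, by simp, by simp, ?_⟩
    intro x hx
    have : x ∈ ⋃ i, V i := Set.mem_iUnion.2 ⟨⟨x, hx⟩, hxV ⟨x, hx⟩⟩
    rw [← hTU] at this
    simp at this
  obtain ⟨e, he⟩ := hT.exists_eq_range hTne
  have hcov : ∀ x ∈ B, ∃ n, x ∈ V (e n) := by
    intro x hx
    have : x ∈ ⋃ i, V i := Set.mem_iUnion.2 ⟨⟨x, hx⟩, hxV ⟨x, hx⟩⟩
    rw [← hTU, he] at this
    simpa using this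
  let O : ℕ → Set X := fun n => V (e n) \ ⋃ m ∈ Finset.range n, closure (V (e m))
  have hOd : ∀ m n, m < n → Disjoint (O m) (O n) := by
    intro m n hmn
    rw [Set.disjoint_left]
    intro x hxm hxn
    exact hxn.2 (Set.mem_biUnion (Finset.mem_coe.2 (Finset.mem_range.2 hmn))
      (subset_closure hxm.1))
  refine ⟨Set.range O, ?_, ?_, ?_, ?_⟩
  · rintro _ ⟨n, rfl⟩
    exact (hV _).sdiff (isClosed_biUnion_finset fun _ _ => isClosed_closure)
  · rintro _ ⟨m, rfl⟩ _ ⟨n, rfl⟩ hne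
    have hmn : m ≠ n := fun h => hne (by rw [h])
    rcases hmn.lt_or_gt with h | h
    · exact hOd _ _ h
    · exact (hOd _ _ h).symm
  · rintro _ ⟨n, rfl⟩
    obtain ⟨U, hU, h⟩ := hVU (e n)
    exact ⟨U, hU, Set.sdiff_subset.trans h⟩
  · intro x hx
    classical
    have hex := hcov x hx
    refine ⟨_, ⟨Nat.find hex, rfl⟩, Nat.find_spec hex, ?_⟩
    simp only [Set.mem_iUnion, Finset.mem_range, not_exists]
    intro m hm hxm
    have hnot := Nat.find_min hex hm
    exact Set.disjoint_left.1 (hd (e m)) ⟨hxm, hBA hx⟩ hnot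

theorem of_countable [SecondCountableTopology X] [TopologicalSpace.MetrizableSpace X] {A : Set X}
    (hA : A.Countable) : IsZeroDimensional A := by
  let _ := TopologicalSpace.metrizableSpaceMetric X
  refine of_basis fun x hx U hU hxU => ?_
  obtain ⟨ε, hε, hball⟩ := Metric.isOpen_iff.1 hU x hxU
  have hc : ((fun y => dist y x) '' A).Countable := hA.image _
  obtain ⟨r, hr, hrA⟩ : ∃ r ∈ Set.Ioo 0 ε, r ∉ (fun y => dist y x) '' A := by
    by_contra! hcon
    exact hε.not_ge (Cardinal.Real.Ioo_countable_iff.1 (hc.mono hcon))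
  refine ⟨Metric.ball x r, Metric.isOpen_ball, Metric.mem_ball_self hr.1,
    (Metric.ball_subset_ball hr.2.le).trans hball, ?_⟩
  rw [Set.disjoint_left]
  rintro y ⟨hy, hyA⟩ hyn
  have h1 := Metric.closure_ball_subset_closedBall hy
  simp only [Metric.mem_closedBall, Set.mem_compl_iff, Metric.mem_ball, not_lt] at h1 hyn
  exact hrA ⟨y, hyA, le_antisymm h1 hyn⟩

theorem image {A : Set X} (hA : IsZeroDimensional A) {j : X → Y} (hj : IsOpenEmbedding j) :
    IsZeroDimensional (j '' A) := by
  intro B hBA 𝒰 h𝒰 hB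
  obtain ⟨𝒱, hV, hd, hr, hc⟩ := hA (j ⁻¹' B) (by
      intro x hx
      obtain ⟨y, hy, hyx⟩ := hBA hx
      exact hj.injective hyx ▸ hy) ((fun U => j ⁻¹' U) '' 𝒰)
    (by rintro _ ⟨U, hU, rfl⟩; exact (h𝒰 U hU).preimage hj.continuous)
    (by
      intro x hx
      obtain ⟨U, hU, h⟩ := hB hx
      exact ⟨_, ⟨U, hU, rfl⟩, h⟩)
  refine ⟨(fun V => j '' V) '' 𝒱, ?_, ?_, ?_, ?_⟩
  · rintro _ ⟨V, h, rfl⟩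
    exact hj.isOpenMap V (hV V h)
  · rintro _ ⟨V, h, rfl⟩ _ ⟨V', h', rfl⟩ hne
    exact (Set.disjoint_image_iff hj.injective).2 (hd h h' fun h => hne (by rw [h]))
  · rintro _ ⟨V, h, rfl⟩
    obtain ⟨_, ⟨U, hU, rfl⟩, hVU⟩ := hr V h
    exact ⟨U, hU, Set.image_subset_iff.2 hVU⟩
  · intro y hy
    obtain ⟨x, -, rfl⟩ := hBA hy
    obtain ⟨V, h, hx⟩ := hc hy
    exact ⟨_, ⟨V, h, rfl⟩, x, hx, rfl⟩

theorem preimage {A : Set Y} (hA : IsZeroDimensional A) {j : X → Y} (hj : IsOpenEmbedding j) :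
    IsZeroDimensional (j ⁻¹' A) := by
  intro B hBA 𝒰 h𝒰 hB
  obtain ⟨𝒱, hV, hd, hr, hc⟩ := hA (j '' B) (Set.image_subset_iff.2 hBA)
    ((fun U => j '' U) '' 𝒰)
    (by rintro _ ⟨U, hU, rfl⟩; exact hj.isOpenMap U (h𝒰 U hU))
    (by
      rintro _ ⟨x, hx, rfl⟩
      obtain ⟨U, hU, h⟩ := hB hx
      exact ⟨_, ⟨U, hU, rfl⟩, x, h, rfl⟩)
  refine ⟨(fun V => j ⁻¹' V) '' 𝒱, ?_, ?_, ?_, ?_⟩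
  · rintro _ ⟨V, h, rfl⟩
    exact (hV V h).preimage hj.continuous
  · rintro _ ⟨V, h, rfl⟩ _ ⟨V', h', rfl⟩ hne
    exact (hd h h' fun h => hne (by rw [h])).preimage j
  · rintro _ ⟨V, h, rfl⟩
    obtain ⟨_, ⟨U, hU, rfl⟩, hVU⟩ := hr V h
    refine ⟨U, hU, fun x hx => ?_⟩
    obtain ⟨x', hx', he⟩ := hVU hx
    exact hj.injective he ▸ hx'
  · intro x hx
    obtain ⟨V, h, hxV⟩ := hc ⟨x, hx, rfl⟩
    exact ⟨_, ⟨V, h, rfl⟩, hxV⟩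

/-- The union of two zero-dimensional sets, one of which is relatively open in the union. -/
theorem union [TopologicalSpace.MetrizableSpace X] {A O : Set X} (hO : IsOpen O)
    (h₁ : IsZeroDimensional (A ∩ O)) (h₂ : IsZeroDimensional (A \ O)) :
    IsZeroDimensional A := by
  let _ := TopologicalSpace.metrizableSpaceMetric X
  intro A' hA' 𝒰 h𝒰 hA𝒰
  obtain ⟨𝒬, hP, hPd, hPU, hPc⟩ := h₂ (A' \ O) (Set.sdiff_subset_sdiff_left hA') 𝒰 h𝒰
    (Set.sdiff_subset.trans hA𝒰)
  set C := A' \ O with hC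
  obtain ⟨𝒱, hV, hVd, hVr, hVc⟩ := h₁ (A' ∩ O) (Set.inter_subset_inter_left _ hA')
    {V | IsOpen V ∧ (∃ U ∈ 𝒰, V ⊆ U) ∧ ∀ c ∈ C, ∀ y ∈ V, ∀ z ∈ V, dist y z ≤ dist z c}
    (fun V h => h.1) (by
      rintro y ⟨hyA, hyO⟩
      obtain ⟨U, hU, hyU⟩ := hA𝒰 hyA
      obtain ⟨ε, hε, hball⟩ := Metric.isOpen_iff.1 hO y hyO
      refine ⟨U ∩ Metric.ball y (ε / 3), ⟨(h𝒰 U hU).inter Metric.isOpen_ball,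
        ⟨U, hU, Set.inter_subset_left⟩, ?_⟩, hyU, Metric.mem_ball_self (by positivity)⟩
      rintro c hc z ⟨-, hz⟩ w ⟨-, hw⟩
      have hcy : ε ≤ dist c y := by
        by_contra! hlt
        exact hc.2 (hball hlt)
      rw [Metric.mem_ball] at hz hw
      have h1 := dist_triangle_right z w y
      have h2 := dist_triangle c w y
      rw [dist_comm c w] at h2
      linarith)
  let shrunk : Set X → Set X := fun P => interior (P \ ⋃₀ {V ∈ 𝒱 | ¬ V ⊆ P})
  have hP' : ∀ P, shrunk P ⊆ P := fun P => interior_subset.trans Set.sdiff_subset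
  refine ⟨shrunk '' 𝒬 ∪ {V ∈ 𝒱 | ∀ P ∈ 𝒬, ¬ V ⊆ P}, ?_, ?_, ?_, ?_⟩
  · rintro _ (⟨P, h, rfl⟩ | h)
    · exact isOpen_interior
    · exact hV _ h.1
  · have hmix : ∀ P ∈ 𝒬, ∀ V ∈ {V ∈ 𝒱 | ∀ P ∈ 𝒬, ¬ V ⊆ P}, Disjoint (shrunk P) V := by
      intro P h V hV'
      rw [Set.disjoint_left]
      intro x hx hxV
      exact (interior_subset hx).2 ⟨V, ⟨hV'.1, hV'.2 P h⟩, hxV⟩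
    rintro _ (⟨P, h, rfl⟩ | h) _ (⟨Q, h', rfl⟩ | h') hne
    · exact (hPd h h' fun e => hne (by rw [e])).mono (hP' _) (hP' _)
    · exact hmix P h _ h'
    · exact (hmix Q h' _ h).symm
    · exact hVd h.1 h'.1 hne
  · rintro _ (⟨P, h, rfl⟩ | h)
    · obtain ⟨U, hU, hPU'⟩ := hPU P h
      exact ⟨U, hU, (hP' P).trans hPU'⟩
    · obtain ⟨W, hW, hVW⟩ := hVr _ h.1
      obtain ⟨U, hU, hWU⟩ := hW.2.1
      exact ⟨U, hU, hVW.trans hWU⟩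
  · intro x hx
    by_cases hxO : x ∈ O
    · obtain ⟨V, hV', hxV⟩ := hVc ⟨hx, hxO⟩
      by_cases hgood : ∃ P ∈ 𝒬, V ⊆ P
      · obtain ⟨P, hP, hVP⟩ := hgood
        refine ⟨shrunk P, Or.inl ⟨P, hP, rfl⟩, interior_maximal ?_ (hV V hV') hxV⟩
        intro y hy
        refine ⟨hVP hy, ?_⟩
        rintro ⟨V', ⟨hV'', hn⟩, hyV'⟩
        by_cases he : V' = V
        · exact hn (he ▸ hVP)
        · exact Set.disjoint_left.1 (hVd hV'' hV' he) hyV' hy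
      · exact ⟨V, Or.inr ⟨hV', by simpa using hgood⟩, hxV⟩
    · obtain ⟨P, hPP, hxP⟩ := hPc ⟨hx, hxO⟩
      refine ⟨shrunk P, Or.inl ⟨P, hPP, rfl⟩, ?_⟩
      obtain ⟨ε, hε, hball⟩ := Metric.isOpen_iff.1 (hP P hPP) x hxP
      refine mem_interior.2 ⟨Metric.ball x (ε / 2), ?_, Metric.isOpen_ball,
        Metric.mem_ball_self (by positivity)⟩
      intro y hy
      refine ⟨hball (Metric.ball_subset_ball (by linarith) hy), ?_⟩
      rintro ⟨V, ⟨hV', hn⟩, hyV⟩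
      obtain ⟨W, hW, hVW⟩ := hVr V hV'
      refine hn fun z hz => hball ?_
      have h1 := hW.2.2 x ⟨hx, hxO⟩ z (hVW hz) y (hVW hyV)
      have h2 := dist_triangle z y x
      rw [Metric.mem_ball] at hy ⊢
      linarith

/-- In a space that is locally contractible in itself, zero-dimensional sets are categorical. -/
theorem isCategorical {A : Set X} (hA : IsZeroDimensional A)
    (h : ∀ x : X, ∃ U, IsOpen U ∧ x ∈ U ∧
      LocallyNullhomotopic ((ContinuousMap.id X).restrict U)) :
    IsCategorical (ContinuousMap.id X) A := by
  obtain ⟨𝒱, hV, hVd, hVr, hVc⟩ := hA A le_rfl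
    {U | IsOpen U ∧ LocallyNullhomotopic ((ContinuousMap.id X).restrict U)} (fun U h => h.1)
    (fun x _ => by
      obtain ⟨U, hU, hx, hl⟩ := h x
      exact ⟨U, ⟨hU, hl⟩, hx⟩)
  rw [Set.sUnion_eq_iUnion] at hVc
  refine (IsCategorical.iUnion (A := fun V : 𝒱 => (V : Set X)) (O := fun V : 𝒱 => (V : Set X))
    (fun V => hV V V.2) (fun _ => le_rfl) ?_ ?_).mono hVc
  · intro V V' hne
    exact hVd V.2 V'.2 fun e => hne (Subtype.ext e)
  · intro V
    obtain ⟨U, hU, hVU⟩ := hVr V V.2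
    exact ⟨V, hV V V.2, le_rfl, IsCategorical.restrict_mono hVU hU.2⟩

end IsZeroDimensional

end ZeroDimensional

section Surface

theorem IsLocallyEuclidean.exists_chart {n : ℕ} {X : Type} [TopologicalSpace X]
    (h : IsLocallyEuclidean n X) {W : Set X} (hW : IsOpen W) {x : X} (hx : x ∈ W) :
    ∃ c : EuclideanSpace ℝ (Fin n) → X, IsOpenEmbedding c ∧ c 0 = x ∧ Set.range c ⊆ W := by
  obtain ⟨U, hxU, hU, ⟨e⟩⟩ := h x
  let d : EuclideanSpace ℝ (Fin n) → X := fun v => (e.symm v : X)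
  have hd : IsOpenEmbedding d := hU.isOpenEmbedding_subtypeVal.comp e.symm.isOpenEmbedding
  let v := e ⟨x, hxU⟩
  have hdv : d v = x := by simp [d, v]
  obtain ⟨r, hr, hball⟩ := Metric.isOpen_iff.1 (hW.preimage hd.continuous) v
    (by simpa [hdv] using hx)
  let b := OpenPartialHomeomorph.univBall v r
  have hb : IsOpenEmbedding b := b.isOpenEmbedding (OpenPartialHomeomorph.univBall_source v r)
  refine ⟨d ∘ b, hd.comp hb, ?_, ?_⟩
  · simp [b, hdv]
  · rintro _ ⟨y, rfl⟩
    apply hball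
    have := b.map_source (x := y) (by simp [b])
    rwa [OpenPartialHomeomorph.univBall_target v hr] at this

theorem IsLocallyEuclidean.subtype {n : ℕ} {X : Type} [TopologicalSpace X]
    (h : IsLocallyEuclidean n X) {W : Set X} (hW : IsOpen W) : IsLocallyEuclidean n W := by
  rintro ⟨x, hx⟩
  obtain ⟨c, hc, hcx, hcW⟩ := h.exists_chart hW hx
  have hc' : IsOpenEmbedding (fun v => (⟨c v, hcW ⟨v, rfl⟩⟩ : W)) :=
    .of_comp _ hW.isOpenEmbedding_subtypeVal hc
  exact ⟨Set.range fun v => (⟨c v, hcW ⟨v, rfl⟩⟩ : W), ⟨0, Subtype.ext hcx⟩, hc'.isOpen_range,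
    ⟨hc'.toIsEmbedding.toHomeomorph.symm⟩⟩

theorem IsLocallyEuclidean.exists_locallyNullhomotopic {n : ℕ} {X : Type} [TopologicalSpace X]
    (h : IsLocallyEuclidean n X) (x : X) : ∃ U, IsOpen U ∧ x ∈ U ∧
      LocallyNullhomotopic ((ContinuousMap.id X).restrict U) := by
  obtain ⟨U, hxU, hU, ⟨e⟩⟩ := h x
  refine ⟨U, hU, hxU, ?_⟩
  have : ContractibleSpace U := e.contractibleSpace
  exact LocallyNullhomotopic.of_factor ((ContinuousMap.id X).restrict U) (ContinuousMap.id U)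

theorem isZeroDimensional_irrational_prod :
    IsZeroDimensional ({x : ℝ | Irrational x} ×ˢ {x : ℝ | Irrational x}) := by
  refine IsZeroDimensional.of_basis ?_
  rintro ⟨x, y⟩ ⟨hx, hy⟩ U hU hxU
  obtain ⟨ε, hε, hball⟩ := Metric.isOpen_iff.1 hU _ hxU
  obtain ⟨a, ha, ha'⟩ := exists_rat_btwn (show x - ε < x by linarith)
  obtain ⟨b, hb, hb'⟩ := exists_rat_btwn (show x < x + ε by linarith)
  obtain ⟨c, hc, hc'⟩ := exists_rat_btwn (show y - ε < y by linarith)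
  obtain ⟨d, hd, hd'⟩ := exists_rat_btwn (show y < y + ε by linarith)
  refine ⟨Set.Ioo (a : ℝ) b ×ˢ Set.Ioo (c : ℝ) d, isOpen_Ioo.prod isOpen_Ioo,
    ⟨⟨ha', hb⟩, hc', hd⟩, ?_, ?_⟩
  · rintro ⟨z, w⟩ ⟨⟨h1, h2⟩, h3, h4⟩
    apply hball
    simp only [Metric.mem_ball, Prod.dist_eq, max_lt_iff, Real.dist_eq, abs_lt] at *
    constructor <;> constructor <;> linarith
  · rw [Set.disjoint_left]
    rintro ⟨z, w⟩ ⟨hcl, hz, hw⟩ hn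
    rw [closure_prod_eq] at hcl
    have h1 := closure_minimal Set.Ioo_subset_Icc_self isClosed_Icc hcl.1
    have h2 := closure_minimal Set.Ioo_subset_Icc_self isClosed_Icc hcl.2
    refine hn ⟨⟨h1.1.lt_of_ne ?_, h1.2.lt_of_ne ?_⟩, h2.1.lt_of_ne ?_, h2.2.lt_of_ne ?_⟩
    · exact fun e => hz.ne_rat _ e.symm
    · exact hz.ne_rat _
    · exact fun e => hw.ne_rat _ e.symm
    · exact hw.ne_rat _

/-- The plane is a union of two zero-dimensional sets and a countable set. -/
theorem exists_zeroDimensional_plane : ∃ R₀ R₁ R₂ : Set (EuclideanSpace ℝ (Fin 2)),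
    IsZeroDimensional R₀ ∧ IsZeroDimensional R₁ ∧ R₂.Countable ∧ R₀ ∪ R₁ ∪ R₂ = Set.univ := by
  let f : EuclideanSpace ℝ (Fin 2) ≃ₜ ℝ × ℝ :=
    { toFun := fun x => (x 0, x 1)
      invFun := fun p => !₂[p.1, p.2]
      left_inv := fun x => by ext i; fin_cases i <;> simp
      right_inv := fun p => by simp
      continuous_toFun := by fun_prop
      continuous_invFun := by fun_prop }
  let g : ℝ × ℝ ≃ₜ ℝ × ℝ :=
    { toFun := fun p => (p.1 + p.2, p.1 - p.2)
      invFun := fun p => ((p.1 + p.2) / 2, (p.1 - p.2) / 2)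
      left_inv := fun p => by ext <;> simp
      right_inv := fun p => by ext <;> simp <;> ring
      continuous_toFun := by fun_prop
      continuous_invFun := by fun_prop }
  refine ⟨_, _, f ⁻¹' (Set.range ((↑) : ℚ → ℝ) ×ˢ Set.range ((↑) : ℚ → ℝ)),
    isZeroDimensional_irrational_prod.preimage f.isOpenEmbedding,
    isZeroDimensional_irrational_prod.preimage (f.trans g).isOpenEmbedding, ?_, ?_⟩
  · exact ((Set.countable_range _).prod (Set.countable_range _)).preimage f.injective
  · rw [Set.eq_univ_iff_forall]
    intro x
    by_cases h0 : x 0 ∈ Set.range ((↑) : ℚ → ℝ) <;> by_cases h1 : x 1 ∈ Set.range ((↑) : ℚ → ℝ)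
    · exact Or.inr ⟨h0, h1⟩
    · obtain ⟨q, hq⟩ := h0
      refine Or.inl (Or.inr ?_)
      change Irrational (x 0 + x 1) ∧ Irrational (x 0 - x 1)
      rw [← hq]
      exact ⟨Irrational.ratCast_add q h1, Irrational.ratCast_sub q h1⟩
    · obtain ⟨q, hq⟩ := h1
      refine Or.inl (Or.inr ?_)
      change Irrational (x 0 + x 1) ∧ Irrational (x 0 - x 1)
      rw [← hq]
      exact ⟨Irrational.add_ratCast q h0, Irrational.sub_ratCast q h0⟩
    · exact Or.inl (Or.inl ⟨h0, h1⟩)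

/-- A compact surface is a union of two zero-dimensional sets and a countable set. -/
theorem exists_zeroDimensional_surface {X : Type} [TopologicalSpace X] [CompactSpace X]
    [TopologicalSpace.MetrizableSpace X] (h : IsLocallyEuclidean 2 X) :
    ∃ Z₀ Z₁ Z₂ : Set X, IsZeroDimensional Z₀ ∧ IsZeroDimensional Z₁ ∧ Z₂.Countable ∧
      Z₀ ∪ Z₁ ∪ Z₂ = Set.univ := by
  choose c hc hcx _ using fun x : X => h.exists_chart isOpen_univ (Set.mem_univ x)
  obtain ⟨t, -, ht⟩ := isCompact_univ.elim_nhds_subcover (fun x : X => Set.range (c x))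
    fun x _ => (hc x).isOpen_range.mem_nhds ⟨0, hcx x⟩
  obtain ⟨R₀, R₁, R₂, hR₀, hR₁, hR₂, hR⟩ := exists_zeroDimensional_plane
  suffices ∀ t : Finset X, ∃ Z₀ Z₁ Z₂ : Set X, IsZeroDimensional Z₀ ∧ IsZeroDimensional Z₁ ∧
      Z₂.Countable ∧ ⋃ x ∈ t, Set.range (c x) ⊆ Z₀ ∪ Z₁ ∪ Z₂ by
    obtain ⟨Z₀, Z₁, Z₂, h₀, h₁, h₂, hZ⟩ := this t
    exact ⟨Z₀, Z₁, Z₂, h₀, h₁, h₂, Set.univ_subset_iff.1 (ht.trans hZ)⟩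
  intro t
  classical
  induction t using Finset.induction_on with
  | empty =>
    refine ⟨∅, ∅, ∅, ?_, ?_, Set.countable_empty, by simp⟩ <;>
    · intro B hB 𝒰 _ _
      exact ⟨∅, by simp, by simp, by simp, hB.trans (by simp)⟩
  | insert a t ha ih =>
    obtain ⟨Z₀, Z₁, Z₂, h₀, h₁, h₂, hZ⟩ := ih
    have key : ∀ {R : Set (EuclideanSpace ℝ (Fin 2))} {Z : Set X}, IsZeroDimensional R →
        IsZeroDimensional Z → IsZeroDimensional (c a '' R ∪ (Z \ Set.range (c a))) := by
      intro R Z hR hZ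
      refine IsZeroDimensional.union (hc a).isOpen_range ((hR.image (hc a)).mono ?_)
        (hZ.mono ?_)
      · rintro x ⟨h | h, h'⟩
        · exact h
        · exact absurd h' h.2
      · rintro x ⟨⟨y, -, rfl⟩ | h, h'⟩
        · exact absurd ⟨y, rfl⟩ h'
        · exact h.1
    refine ⟨_, _, c a '' R₂ ∪ Z₂, key hR₀ h₀, key hR₁ h₁, (hR₂.image _).union h₂, ?_⟩
    rw [Finset.set_biUnion_insert]
    rintro x hx
    by_cases hxa : x ∈ Set.range (c a)
    · obtain ⟨v, rfl⟩ := hxa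
      rcases (Set.eq_univ_iff_forall.1 hR v) with (hv | hv) | hv
      · exact Or.inl (Or.inl (Or.inl ⟨v, hv, rfl⟩))
      · exact Or.inl (Or.inr (Or.inl ⟨v, hv, rfl⟩))
      · exact Or.inr (Or.inl ⟨v, hv, rfl⟩)
    · rcases hZ (hx.resolve_left hxa) with (hv | hv) | hv
      · exact Or.inl (Or.inl (Or.inr ⟨hv, hxa⟩))
      · exact Or.inl (Or.inr (Or.inr ⟨hv, hxa⟩))
      · exact Or.inr (Or.inr hv)

/-- A decomposition of a compact surface adapted to a chart around a point `a`: the strata `A₀`,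
`A₁`, `V₂` are categorical in the complement of `a`, and the fourth stratum is a disc. -/
theorem exists_surface_decomposition {X : Type} [TopologicalSpace X] [CompactSpace X]
    [TopologicalSpace.MetrizableSpace X] (h : IsLocallyEuclidean 2 X)
    {c : EuclideanSpace ℝ (Fin 2) → X} (hc : IsOpenEmbedding c) :
    ∃ (ρ : ℝ) (A₀ A₁ V₂ : Set X), 0 < ρ ∧ IsClosed A₀ ∧ IsClosed (A₀ ∪ A₁) ∧ IsOpen V₂ ∧
      Disjoint A₀ A₁ ∧ (A₀ ∪ A₁)ᶜ = V₂ ∪ c '' Metric.ball 0 ρ ∧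
      Disjoint V₂ (c '' Metric.closedBall 0 ρ) ∧
      ∀ A ∈ ({A₀, A₁, V₂} : Set (Set X)),
        IsCategorical (ContinuousMap.id ({c 0}ᶜ : Set X)) ((↑) ⁻¹' A) := by
  have hop : IsOpen ({c 0}ᶜ : Set X) := isOpen_compl_singleton
  have hval := hop.isOpenEmbedding_subtypeVal
  obtain ⟨Z₀, Z₁, Z₂, h₀, h₁, h₂, hZ⟩ := exists_zeroDimensional_surface h
  have hloc := (h.subtype hop).exists_locallyNullhomotopic
  obtain ⟨U₀, hU₀, hZU₀, hl₀⟩ := (h₀.preimage hval).isCategorical hloc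
  obtain ⟨U₁, hU₁, hZU₁, hl₁⟩ := (h₁.preimage hval).isCategorical hloc
  set V₀ : Set X := (↑) '' U₀ with hV₀
  set V₁ : Set X := (↑) '' U₁ with hV₁
  have hV₀o : IsOpen V₀ := hval.isOpenMap _ hU₀
  have hV₁o : IsOpen V₁ := hval.isOpenMap _ hU₁
  have hQ : ((V₀ ∪ V₁)ᶜ).Countable := by
    refine (h₂.insert (c 0)).mono fun x hx => ?_
    by_cases hxa : x = c 0
    · exact Or.inl hxa
    · rcases (Set.eq_univ_iff_forall.1 hZ x) with (hv | hv) | hv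
      · exact absurd (Or.inl ⟨⟨x, hxa⟩, hZU₀ hv, rfl⟩) hx
      · exact absurd (Or.inr ⟨⟨x, hxa⟩, hZU₁ hv, rfl⟩) hx
      · exact Or.inr hv
  set Q := (V₀ ∪ V₁)ᶜ with hQdef
  obtain ⟨ρ, hρ, hρQ⟩ : ∃ ρ ∈ Set.Ioo (0 : ℝ) 1, ρ ∉ norm '' (c ⁻¹' Q) := by
    by_contra! hcon
    exact zero_lt_one.not_ge (Cardinal.Real.Ioo_countable_iff.1
      (((hQ.preimage hc.injective).image _).mono hcon))
  have hE : IsClosed (c '' Metric.closedBall 0 ρ) :=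
    ((isCompact_closedBall _ _).image hc.continuous).isClosed
  obtain ⟨U₂, hU₂, hQU₂, hl₂⟩ := ((IsZeroDimensional.of_countable hQ).preimage
    hval).isCategorical hloc
  let V₂ : Set X := (↑) '' U₂ \ c '' Metric.closedBall 0 ρ
  have hV₂o : IsOpen V₂ := (hval.isOpenMap _ hU₂).sdiff hE
  have hbo : IsOpen (c '' Metric.ball 0 ρ) := hc.isOpenMap _ Metric.isOpen_ball
  have hA₀V : (V₁ ∪ (V₂ ∪ c '' Metric.ball 0 ρ))ᶜ ⊆ V₀ := by
    intro x hx
    simp only [Set.mem_compl_iff, Set.mem_union, not_or] at hx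
    by_contra hx0
    have hxQ : x ∈ Q := by simp [hQdef, hx0, hx.1]
    by_cases hxE : x ∈ c '' Metric.closedBall 0 ρ
    · obtain ⟨v, hv, rfl⟩ := hxE
      have : ‖v‖ ≠ ρ := fun e => hρQ ⟨v, hxQ, e⟩
      rw [mem_closedBall_zero_iff] at hv
      exact hx.2.2 ⟨v, mem_ball_zero_iff.2 (hv.lt_of_ne this), rfl⟩
    · have hxa : x ≠ c 0 := by
        rintro rfl
        exact hxE ⟨0, Metric.mem_closedBall_self hρ.1.le, rfl⟩
      exact hx.2.1 ⟨⟨⟨x, hxa⟩, hQU₂ hxQ, rfl⟩, hxE⟩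
  have hunion : (V₁ ∪ (V₂ ∪ c '' Metric.ball 0 ρ))ᶜ ∪ (V₁ \ (V₂ ∪ c '' Metric.ball 0 ρ)) =
      (V₂ ∪ c '' Metric.ball 0 ρ)ᶜ := by
    ext x
    simp only [Set.mem_compl_iff, Set.mem_union, Set.mem_sdiff]
    tauto
  refine ⟨ρ, (V₁ ∪ (V₂ ∪ c '' Metric.ball 0 ρ))ᶜ, V₁ \ (V₂ ∪ c '' Metric.ball 0 ρ), V₂, hρ.1,
    (hV₁o.union (hV₂o.union hbo)).isClosed_compl, ?_, hV₂o, ?_, ?_, Set.disjoint_sdiff_left, ?_⟩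
  · rw [hunion]
    exact (hV₂o.union hbo).isClosed_compl
  · rw [Set.disjoint_left]
    exact fun x hx hx' => hx (Or.inl hx'.1)
  · rw [hunion, compl_compl]
  · have hpre : ∀ U : Set ({c 0}ᶜ : Set X), (↑) ⁻¹' ((↑) '' U : Set X) = U := fun U =>
      Set.preimage_image_eq U Subtype.val_injective
    rintro A (rfl | rfl | rfl)
    · exact ⟨U₀, hU₀, (Set.preimage_mono hA₀V).trans (hpre U₀).subset, hl₀⟩
    · exact ⟨U₁, hU₁, (Set.preimage_mono Set.sdiff_subset).trans (hpre U₁).subset, hl₁⟩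
    · exact ⟨U₂, hU₂, (Set.preimage_mono Set.sdiff_subset).trans (hpre U₂).subset, hl₂⟩

end Surface

section PuncturedProduct

theorem contractibleSpace_sphere_compl_singleton {n : ℕ}
    (v : Metric.sphere (0 : EuclideanSpace ℝ (Fin (n + 1))) 1) :
    ContractibleSpace ({v}ᶜ : Set (Metric.sphere (0 : EuclideanSpace ℝ (Fin (n + 1))) 1)) := by
  have : Fact (Module.finrank ℝ (EuclideanSpace ℝ (Fin (n + 1))) = n + 1) := ⟨by simp⟩
  have e := (stereographic' n v).toHomeomorphSourceTarget
  rw [stereographic'_source, stereographic'_target] at e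
  exact (e.trans (Homeomorph.Set.univ _)).contractibleSpace

/-- A filtration by three closed sets whose four strata are categorical. -/
structure IsCategoricalFiltration {X : Type*} [TopologicalSpace X] (F₀ F₁ F₂ : Set X) : Prop where
  closed₀ : IsClosed F₀
  closed₁ : IsClosed F₁
  closed₂ : IsClosed F₂
  subset₁ : F₀ ⊆ F₁
  subset₂ : F₁ ⊆ F₂
  cat₀ : IsCategorical (ContinuousMap.id X) F₀
  cat₁ : IsCategorical (ContinuousMap.id X) (F₁ \ F₀)
  cat₂ : IsCategorical (ContinuousMap.id X) (F₂ \ F₁)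
  cat₃ : IsCategorical (ContinuousMap.id X) F₂ᶜ

theorem IsCategoricalFiltration.preimage {X : Type*} [TopologicalSpace X] {F₀ F₁ F₂ : Set X}
    (h : IsCategoricalFiltration F₀ F₁ F₂) {f : C(X, X)}
    (hf : (ContinuousMap.id X).Homotopic f) :
    IsCategoricalFiltration (f ⁻¹' F₀) (f ⁻¹' F₁) (f ⁻¹' F₂) where
  closed₀ := h.closed₀.preimage f.continuous
  closed₁ := h.closed₁.preimage f.continuous
  closed₂ := h.closed₂.preimage f.continuous
  subset₁ := Set.preimage_mono h.subset₁
  subset₂ := Set.preimage_mono h.subset₂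
  cat₀ := (h.cat₀.comp_right f).of_homotopic hf
  cat₁ := (h.cat₁.comp_right f).of_homotopic hf
  cat₂ := (h.cat₂.comp_right f).of_homotopic hf
  cat₃ := (h.cat₃.comp_right f).of_homotopic hf

theorem IsCategorical.of_subset_contractible {X : Type*} [TopologicalSpace X] {A U : Set X}
    (hU : IsOpen U) [ContractibleSpace U] (hAU : A ⊆ U) :
    IsCategorical (ContinuousMap.id X) A :=
  ⟨U, hU, hAU, LocallyNullhomotopic.of_factor ((ContinuousMap.id X).restrict U)
    (ContinuousMap.id U)⟩

/-- A function separating a point of an open set from the complement of the open set. -/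
theorem exists_continuous_eq_zero_iff {X : Type*} [TopologicalSpace X]
    [TopologicalSpace.MetrizableSpace X] {D : Set X} (hD : IsOpen D) {a : X} (ha : a ∈ D)
    (hne : Dᶜ.Nonempty) : ∃ u : C(X, ℝ), (∀ x, 0 ≤ u x) ∧ (∀ x, u x ≤ 1) ∧
      (∀ x, u x = 0 ↔ x = a) ∧ ∀ x, u x < 1 ↔ x ∈ D := by
  let _ := TopologicalSpace.metrizableSpaceMetric X
  have hpos : ∀ x, x ∈ D → 0 < Metric.infDist x Dᶜ := fun x hx =>
    (hD.isClosed_compl.notMem_iff_infDist_pos hne).1 (by simpa using hx)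
  have hzero : ∀ x, x ∉ D → Metric.infDist x Dᶜ = 0 := fun x hx =>
    Metric.infDist_zero_of_mem hx
  have hden : ∀ x, 0 < dist x a + Metric.infDist x Dᶜ := by
    intro x
    by_cases hx : x ∈ D
    · have := hpos x hx
      positivity
    · have : 0 < dist x a := dist_pos.2 fun e => hx (e ▸ ha)
      rw [hzero x hx]
      linarith
  refine ⟨⟨fun x => dist x a / (dist x a + Metric.infDist x Dᶜ), ?_⟩, ?_, ?_, ?_, ?_⟩
  · exact Continuous.div (by fun_prop) (by fun_prop) fun x => (hden x).ne'
  · intro x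
    exact div_nonneg dist_nonneg (hden x).le
  · intro x
    exact (div_le_one (hden x)).2 (le_add_of_nonneg_right Metric.infDist_nonneg)
  · intro x
    simp [div_eq_zero_iff, (hden x).ne']
  · intro x
    change dist x a / _ < 1 ↔ _
    rw [div_lt_one (hden x), lt_add_iff_pos_right]
    refine ⟨fun h => ?_, hpos x⟩
    by_contra hx
    exact h.ne' (hzero x hx)

variable {X S E : Type*} [TopologicalSpace X] [TopologicalSpace S] [TopologicalSpace E]
  [TopologicalSpace.MetrizableSpace X] [TopologicalSpace.MetrizableSpace S]

/-- A categorical set in `X` minus a point times a categorical set in `S` is categorical in the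
punctured product. -/
theorem IsCategorical.prod_punctured {a : X} (b : S) {A : Set X} {B : Set S}
    (hA : IsCategorical (ContinuousMap.id ({a}ᶜ : Set X)) ((↑) ⁻¹' A)) (haA : a ∉ A)
    (hB : IsCategorical (ContinuousMap.id S) B) :
    IsCategorical (ContinuousMap.id ({(a, b)}ᶜ : Set (X × S))) ((↑) ⁻¹' (A ×ˢ B)) := by
  let j : C(({a}ᶜ : Set X) × S, ({(a, b)}ᶜ : Set (X × S))) :=
    ⟨fun p => ⟨(p.1, p.2), fun h => p.1.2 (congrArg Prod.fst h)⟩, by fun_prop⟩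
  have hj : IsOpenEmbedding j := by
    refine .of_comp j (isOpen_compl_singleton (x := (a, b))).isOpenEmbedding_subtypeVal ?_
    exact (isOpen_compl_singleton (x := a)).isOpenEmbedding_subtypeVal.prodMap .id
  refine (IsCategorical.image (f := ContinuousMap.id _) hj
    (((hA.prodMap hB).comp_left j))).mono ?_
  rintro ⟨⟨x, y⟩, hp⟩ ⟨hx, hy⟩
  have hxa : x ≠ a := fun e => haA (e ▸ hx)
  exact ⟨(⟨x, hxa⟩, y), ⟨hx, hy⟩, rfl⟩

theorem IsCategorical.contractible_prod_punctured [ContractibleSpace E] {c : E → X}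
    (hc : IsOpenEmbedding c) (a : X) {b : S} [ContractibleSpace ({b}ᶜ : Set S)] :
    IsCategorical (ContinuousMap.id ({(a, b)}ᶜ : Set (X × S)))
      ((↑) ⁻¹' (Set.range c ×ˢ {b}ᶜ)) := by
  let j : C(E × ({b}ᶜ : Set S), ({(a, b)}ᶜ : Set (X × S))) :=
    ⟨fun p => ⟨(c p.1, p.2), fun h => p.2.2 (congrArg Prod.snd h)⟩, by
      have := hc.continuous
      fun_prop⟩
  have hj : IsOpenEmbedding j := by
    refine .of_comp j (isOpen_compl_singleton (x := (a, b))).isOpenEmbedding_subtypeVal ?_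
    exact hc.prodMap (isOpen_compl_singleton (x := b)).isOpenEmbedding_subtypeVal
  have huniv : IsCategorical ((ContinuousMap.id _).comp j) Set.univ :=
    ⟨Set.univ, isOpen_univ, le_rfl,
      LocallyNullhomotopic.of_factor ((ContinuousMap.id _).comp j) ⟨_, continuous_subtype_val⟩⟩
  refine (IsCategorical.image hj huniv).mono ?_
  rintro ⟨⟨_, y⟩, hp⟩ ⟨⟨v, rfl⟩, hy⟩
  exact ⟨(v, ⟨y, hy⟩), trivial, rfl⟩

theorem IsCategorical.punctured_prod_contractible [ContractibleSpace E] {c : E → X}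
    (hc : IsOpenEmbedding c) (a : X) {b b' : S}
    [ContractibleSpace ({b'}ᶜ : Set S)] (hex : ∃ y₀ : S, y₀ ≠ b' ∧ y₀ ≠ b) :
    IsCategorical (ContinuousMap.id ({(a, b)}ᶜ : Set (X × S)))
      ((↑) ⁻¹' ((Set.range c \ {a}) ×ˢ {b'}ᶜ)) := by
  obtain ⟨y₀, hy₀, hy₀b⟩ := hex
  let U : Set ({(a, b)}ᶜ : Set (X × S)) := (↑) ⁻¹' ((Set.range c \ {a}) ×ˢ {b'}ᶜ)
  have hU : IsOpen U := ((hc.isOpen_range.sdiff isClosed_singleton).prod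
    isOpen_compl_singleton).preimage continuous_subtype_val
  refine ⟨U, hU, le_rfl, ?_⟩
  let e := hc.toIsEmbedding.toHomeomorph
  let r : C(U, E) := ⟨fun p => e.symm ⟨p.1.1.1, p.2.1.1⟩, by fun_prop⟩
  let k : C(E, ({(a, b)}ᶜ : Set (X × S))) :=
    ⟨fun v => ⟨(c v, y₀), fun h => hy₀b (congrArg Prod.snd h)⟩, by
      have := hc.continuous
      fun_prop⟩
  have hcr : ∀ p : U, c (r p) = p.1.1.1 := fun p =>
    congrArg Subtype.val (e.apply_symm_apply ⟨p.1.1.1, p.2.1.1⟩)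
  refine (LocallyNullhomotopic.of_factor k r).of_homotopic ?_
  obtain ⟨z, hz⟩ := id_nullhomotopic ({b'}ᶜ : Set S)
  have hz' := hz.trans (ContinuousMap.homotopic_const_iff.2
    (PathConnectedSpace.joined z (⟨y₀, hy₀⟩ : ({b'}ᶜ : Set S))))
  obtain ⟨G⟩ := hz'
  refine ⟨⟨⟨fun q => ⟨(q.2.1.1.1, (G (q.1, ⟨q.2.1.1.2, q.2.2.2⟩) : S)), fun h =>
    q.2.2.1.2 (congrArg Prod.fst h)⟩, by fun_prop⟩, ?_, ?_⟩⟩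
  · intro p
    simp
  · intro p
    apply Subtype.ext
    simp [k, hcr]

/-- The filtration of a punctured product of a surface and a sphere. -/
theorem exists_isCategoricalFiltration_punctured [ContractibleSpace E] {c : E → X}
    (hc : IsOpenEmbedding c) {a : X} {b b' : S} (hbb' : b ≠ b')
    [ContractibleSpace ({b}ᶜ : Set S)] [ContractibleSpace ({b'}ᶜ : Set S)]
    (hex : ∃ y₀ : S, y₀ ≠ b' ∧ y₀ ≠ b) {A₀ A₁ V₂ D : Set X} (hA₀ : IsClosed A₀)
    (hA₁ : IsClosed (A₀ ∪ A₁)) (hV₂ : IsOpen V₂) (hD : IsOpen D) (ha : a ∈ D)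
    (hDne : Dᶜ.Nonempty) (hA : Disjoint A₀ A₁) (hcompl : (A₀ ∪ A₁)ᶜ = V₂ ∪ D)
    (hVD : Disjoint V₂ D) (hDc : closure D ⊆ Set.range c)
    (hcat₀ : IsCategorical (ContinuousMap.id ({a}ᶜ : Set X)) ((↑) ⁻¹' A₀))
    (hcat₁ : IsCategorical (ContinuousMap.id ({a}ᶜ : Set X)) ((↑) ⁻¹' A₁))
    (hcat₂ : IsCategorical (ContinuousMap.id ({a}ᶜ : Set X)) ((↑) ⁻¹' V₂)) :
    ∃ F₀ F₁ F₂ : Set ({(a, b)}ᶜ : Set (X × S)), IsCategoricalFiltration F₀ F₁ F₂ ∧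
      ∃ O : Set (X × S), IsOpen O ∧ (a, b) ∈ O ∧ ∀ p ∈ F₂ \ F₀, (p : X × S) ∉ O := by
  obtain ⟨u, hu0, hu1, hua, huD⟩ := exists_continuous_eq_zero_iff hD ha hDne
  obtain ⟨v, hv0, hv1, hvb, hvb'⟩ := exists_continuous_eq_zero_iff
    (isOpen_compl_singleton (x := b')) (a := b) hbb' ⟨b', by simp⟩
  have hvb'' : ∀ y, v y = 1 ↔ y = b' := by
    intro y
    have h1 := hvb' y
    have h2 := hv1 y
    constructor
    · intro h
      by_contra hne
      exact (h1.2 hne).ne h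
    · intro h
      by_contra hne
      exact h1.1 (lt_of_le_of_ne h2 hne) h
  -- membership in the four pieces of the surface
  have hdec : ∀ x, x ∈ A₀ ∨ x ∈ A₁ ∨ x ∈ V₂ ∨ x ∈ D := by
    intro x
    by_cases hx : x ∈ A₀ ∪ A₁
    · rcases hx with h | h <;> simp [h]
    · rw [← Set.mem_compl_iff, hcompl] at hx
      rcases hx with h | h <;> simp [h]
  have hAV : ∀ x, x ∈ A₀ ∪ A₁ → x ∉ V₂ ∧ x ∉ D := by
    intro x hx
    have : x ∉ (A₀ ∪ A₁)ᶜ := fun h => h hx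
    rw [hcompl] at this
    simpa [not_or] using this
  have hVD' : Disjoint V₂ (closure D) := hVD.closure_right hV₂
  have haA : a ∉ A₀ ∪ A₁ := fun h => (hAV a h).2 ha
  have haV : a ∉ V₂ := fun h => Set.disjoint_left.1 hVD h ha
  let TN : Set (X × S) := {p | p.1 ∈ closure D ∧ 2 * v p.2 ≤ u p.1}
  have hTN : IsClosed TN := (isClosed_closure.preimage continuous_fst).inter
    (isClosed_le (f := fun p : X × S => 2 * v p.2) (g := fun p => u p.1) (by fun_prop)
      (by fun_prop))
  let TS : Set (X × S) := {p | u p.1 < 2 * v p.2 ∧ p.1 ∈ D ∧ p.2 ∈ ({b'}ᶜ : Set S)}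
  have hTS : IsOpen TS := (isOpen_lt (f := fun p : X × S => u p.1) (g := fun p => 2 * v p.2)
    (by fun_prop) (by fun_prop)).inter
    ((hD.preimage continuous_fst).inter (isOpen_compl_singleton.preimage continuous_snd))
  have hTNv : ∀ p ∈ TN, p.2 ≠ b' := by
    rintro p ⟨-, hp⟩ hpb
    have h1 := (hvb'' p.2).2 hpb
    have h2 := hu1 p.1
    linarith
  let F₀ : Set (X × S) := A₀ ×ˢ {b'} ∪ TN
  let F₁ : Set (X × S) := (A₀ ∪ A₁) ×ˢ {b'} ∪ A₀ ×ˢ Set.univ ∪ TN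
  let F₂ : Set (X × S) := (TS ∪ V₂ ×ˢ {b'}ᶜ)ᶜ
  have hF₀ : IsClosed F₀ := (hA₀.prod isClosed_singleton).union hTN
  have hF₁ : IsClosed F₁ :=
    ((hA₁.prod isClosed_singleton).union (hA₀.prod isClosed_univ)).union hTN
  have hF₂ : IsClosed F₂ := (hTS.union (hV₂.prod isOpen_compl_singleton)).isClosed_compl
  have hB : IsCategorical (ContinuousMap.id S) ({b'} : Set S) :=
    .of_subset_contractible (U := {b}ᶜ) isOpen_compl_singleton (by simpa using hbb')
  have hB' : IsCategorical (ContinuousMap.id S) ({b'}ᶜ : Set S) :=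
    .of_subset_contractible (U := {b'}ᶜ) isOpen_compl_singleton le_rfl
  have hcdisc := IsCategorical.contractible_prod_punctured hc a (b := b)
  have hval : Continuous ((↑) : ({(a, b)}ᶜ : Set (X × S)) → X × S) := continuous_subtype_val
  -- separated unions of strata, checked in the product
  have hsep : ∀ {P Q : Set (X × S)} {K L : Set (X × S)}, IsClosed K → IsClosed L → P ⊆ K → Q ⊆ L →
      Disjoint K Q → Disjoint P L →
      IsCategorical (ContinuousMap.id ({(a, b)}ᶜ : Set (X × S))) ((↑) ⁻¹' P) →
      IsCategorical (ContinuousMap.id ({(a, b)}ᶜ : Set (X × S))) ((↑) ⁻¹' Q) →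
      IsCategorical (ContinuousMap.id ({(a, b)}ᶜ : Set (X × S))) ((↑) ⁻¹' (P ∪ Q)) := by
    intro P Q K L hK hL hPK hQL h1 h2 hP hQ
    refine hP.union_of_separated hQ ?_ ?_
    · exact (h1.preimage _).mono_left (closure_minimal (Set.preimage_mono hPK) (hK.preimage hval))
    · exact (h2.preimage _).mono_right (closure_minimal (Set.preimage_mono hQL) (hL.preimage hval))
  have hopen : ∀ {P Q : Set (X × S)} {K L : Set (X × S)}, IsOpen K → IsOpen L → P ⊆ K → Q ⊆ L →
      Disjoint K L →
      IsCategorical (ContinuousMap.id ({(a, b)}ᶜ : Set (X × S))) ((↑) ⁻¹' P) →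
      IsCategorical (ContinuousMap.id ({(a, b)}ᶜ : Set (X × S))) ((↑) ⁻¹' Q) →
      IsCategorical (ContinuousMap.id ({(a, b)}ᶜ : Set (X × S))) ((↑) ⁻¹' (P ∪ Q)) := by
    intro P Q K L hK hL hPK hQL h1 hP hQ
    exact hP.union hQ (hK.preimage hval) (hL.preimage hval) (Set.preimage_mono hPK)
      (Set.preimage_mono hQL) (h1.preimage _)
  refine ⟨(↑) ⁻¹' F₀, (↑) ⁻¹' F₁, (↑) ⁻¹' F₂, ⟨hF₀.preimage hval, hF₁.preimage hval,
    hF₂.preimage hval, Set.preimage_mono ?_, Set.preimage_mono ?_, ?_, ?_, ?_, ?_⟩,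
    D ×ˢ {b'}ᶜ, hD.prod isOpen_compl_singleton, ⟨ha, hbb'⟩, ?_⟩
  · rintro p (h | h)
    · exact Or.inl (Or.inl ⟨Or.inl h.1, h.2⟩)
    · exact Or.inr h
  · rintro p hp (h | h)
    · rcases hp with (hp | hp) | hp
      · exact h.2.2 hp.2
      · exact (hAV _ (Or.inl hp.1)).2 h.2.1
      · exact hp.2.not_gt h.1
    · rcases hp with (hp | hp) | hp
      · exact h.2 hp.2
      · exact (hAV _ (Or.inl hp.1)).1 h.1
      · exact Set.disjoint_left.1 hVD' h.1 hp.1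
  · refine hsep (hA₀.prod isClosed_singleton) hTN le_rfl le_rfl ?_ ?_
      (hcat₀.prod_punctured b (fun h => haA (Or.inl h)) hB) ?_
    · exact Set.disjoint_left.2 fun p hp hp' => hTNv p hp' hp.2
    · exact Set.disjoint_left.2 fun p hp hp' => hTNv p hp' hp.2
    · refine (IsCategorical.punctured_prod_contractible hc a hex).mono ?_
      rintro ⟨⟨x, y⟩, hp⟩ hT
      refine ⟨⟨hDc hT.1, ?_⟩, hTNv _ hT⟩
      rintro (rfl : x = a)
      have h1 := (hua x).2 rfl
      have h2 : 2 * v y ≤ u x := hT.2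
      have h3 : v y = 0 := le_antisymm (by linarith) (hv0 y)
      exact hp (by rw [(hvb y).1 h3]; rfl)
  · refine IsCategorical.mono (B := (↑) ⁻¹' (A₁ ×ˢ {b'} ∪ A₀ ×ˢ {b'}ᶜ)) ?_ ?_
    · refine hsep (K := Set.univ ×ˢ {b'}) (L := A₀ ×ˢ Set.univ)
        (isClosed_univ.prod isClosed_singleton) (hA₀.prod isClosed_univ) ?_ ?_ ?_ ?_
        (hcat₁.prod_punctured b (fun h => haA (Or.inr h)) hB)
        (hcat₀.prod_punctured b (fun h => haA (Or.inl h)) hB')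
      · exact fun p hp => ⟨trivial, hp.2⟩
      · exact fun p hp => ⟨hp.1, trivial⟩
      · exact Set.disjoint_left.2 fun p hp hp' => hp'.2 hp.2
      · exact Set.disjoint_left.2 fun p hp hp' => Set.disjoint_left.1 hA hp'.1 hp.1
    · rintro p ⟨(hp | hp) | hp, hn⟩
      · rcases hp.1 with h | h
        · exact absurd (Or.inl ⟨h, hp.2⟩) hn
        · exact Or.inl ⟨h, hp.2⟩
      · exact Or.inr ⟨hp.1, fun h => hn (Or.inl ⟨hp.1, h⟩)⟩
      · exact absurd (Or.inr hp) hn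
  · refine IsCategorical.mono
      (B := (↑) ⁻¹' ((D ×ˢ {b'} ∪ V₂ ×ˢ {b'}) ∪ A₁ ×ˢ {b'}ᶜ)) ?_ ?_
    · refine hsep (K := Set.univ ×ˢ {b'}) (L := (A₀ ∪ A₁) ×ˢ Set.univ)
        (isClosed_univ.prod isClosed_singleton) (hA₁.prod isClosed_univ) ?_ ?_ ?_ ?_ ?_
        (hcat₁.prod_punctured b (fun h => haA (Or.inr h)) hB')
      · rintro p (hp | hp) <;> exact ⟨trivial, hp.2⟩
      · exact fun p hp => ⟨Or.inr hp.1, trivial⟩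
      · exact Set.disjoint_left.2 fun p hp hp' => hp'.2 hp.2
      · refine Set.disjoint_left.2 ?_
        rintro p (hp | hp) hp'
        · exact (hAV _ hp'.1).2 hp.1
        · exact (hAV _ hp'.1).1 hp.1
      · refine hopen (K := D ×ˢ Set.univ) (L := V₂ ×ˢ Set.univ) (hD.prod isOpen_univ)
          (hV₂.prod isOpen_univ) ?_ ?_ ?_ (hcdisc.mono (Set.preimage_mono ?_))
          (hcat₂.prod_punctured b haV hB)
        · exact fun p hp => ⟨hp.1, trivial⟩
        · exact fun p hp => ⟨hp.1, trivial⟩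
        · exact Set.disjoint_left.2 fun p hp hp' => Set.disjoint_left.1 hVD hp'.1 hp.1
        · rintro p ⟨h1, h2⟩
          exact ⟨hDc (subset_closure h1), fun h => hbb' (h.symm.trans h2)⟩
    · rintro p ⟨hp2, hp1⟩
      rcases hdec p.1.1 with h | h | h | h
      · exact absurd (Or.inl (Or.inr ⟨h, trivial⟩)) hp1
      · by_cases hb : p.1.2 = b'
        · exact absurd (Or.inl (Or.inl ⟨Or.inr h, hb⟩)) hp1
        · exact Or.inr ⟨h, hb⟩
      · by_cases hb : p.1.2 = b'
        · exact Or.inl (Or.inr ⟨h, hb⟩)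
        · exact absurd (Or.inr ⟨h, hb⟩) hp2
      · by_cases hb : p.1.2 = b'
        · exact Or.inl (Or.inl ⟨h, hb⟩)
        · rcases le_or_gt (2 * v p.1.2) (u p.1.1) with hle | hlt
          · exact absurd (Or.inr ⟨subset_closure h, hle⟩) hp1
          · exact absurd (Or.inl ⟨hlt, h, hb⟩) hp2
  · rw [← Set.preimage_compl, compl_compl]
    refine hopen (K := D ×ˢ Set.univ) (L := V₂ ×ˢ Set.univ) (hD.prod isOpen_univ)
      (hV₂.prod isOpen_univ) ?_ ?_ ?_ (hcdisc.mono (Set.preimage_mono ?_))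
      (hcat₂.prod_punctured b haV hB')
    · exact fun p hp => ⟨hp.2.1, trivial⟩
    · exact fun p hp => ⟨hp.1, trivial⟩
    · exact Set.disjoint_left.2 fun p hp hp' => Set.disjoint_left.1 hVD hp'.1 hp.1
    · rintro p ⟨h1, h2, -⟩
      refine ⟨hDc (subset_closure h2), fun h => ?_⟩
      have h3 := (hvb p.2).2 h
      have h4 := hu0 p.1
      linarith
  · rintro p ⟨hp2, hp0⟩ ⟨h, hb⟩
    rcases le_or_gt (2 * v p.1.2) (u p.1.1) with hle | hlt
    · exact hp0 (Or.inr ⟨subset_closure h, hle⟩)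
    · exact hp2 (Or.inl ⟨hlt, h, hb⟩)

end PuncturedProduct

section Radial

variable {T E M Z : Type*} [TopologicalSpace T] [NormedAddCommGroup E]
  [TopologicalSpace M] [T2Space M] [TopologicalSpace Z]

/-- Gluing a map defined on a punctured chart with a map defined on the whole space. -/
theorem exists_glue_punctured [ProperSpace E] {φ : E → M} (hφ : IsOpenEmbedding φ) {R : ℝ}
    {f : T × E → Z}
    (hf : ∀ t x, x ≠ 0 → ContinuousAt f (t, x)) (k : C(T × M, Z))
    (hfk : ∀ t x, R ≤ ‖x‖ → f (t, x) = k (t, φ x)) :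
    ∃ F : C(T × ({φ 0}ᶜ : Set M), Z), (∀ t x hx, F (t, ⟨φ x, hx⟩) = f (t, x)) ∧
      ∀ t (p : ({φ 0}ᶜ : Set M)), (p : M) ∉ Set.range φ → F (t, p) = k (t, p) := by
  let F : T × M → Z := Function.extend (Prod.map id φ) f k
  have hemb : IsOpenEmbedding (Prod.map id φ : T × E → T × M) := IsOpenEmbedding.id.prodMap hφ
  have hF₁ : ∀ t x, F (t, φ x) = f (t, x) := fun t x =>
    hemb.injective.extend_apply f k (t, x)
  have hF₂ : ∀ t m, m ∉ Set.range φ → F (t, m) = k (t, m) := by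
    intro t m hm
    refine Function.extend_apply' f k (t, m) ?_
    rintro ⟨q, hq⟩
    exact hm ⟨q.2, congrArg Prod.snd hq⟩
  have hcont : ∀ t m, m ≠ φ 0 → ContinuousAt F (t, m) := by
    intro t m hm
    by_cases hr : m ∈ Set.range φ
    · obtain ⟨x, rfl⟩ := hr
      have hx : x ≠ 0 := fun h => hm (by rw [h])
      refine (hemb.continuousAt_iff (f := Prod.map id φ) (x := (t, x))).1 ?_
      have : F ∘ Prod.map id φ = f := by
        funext q
        exact hF₁ q.1 q.2
      rw [this]
      exact hf t x hx
    · have ho : IsOpen ((φ '' Metric.closedBall 0 R)ᶜ) :=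
        ((isCompact_closedBall _ _).image hφ.continuous).isClosed.isOpen_compl
      have hmem : (t, m) ∈ (Set.univ : Set T) ×ˢ (φ '' Metric.closedBall 0 R)ᶜ := by
        refine ⟨trivial, ?_⟩
        rintro ⟨x, -, hx⟩
        exact hr ⟨x, hx⟩
      refine k.continuous.continuousAt.congr ?_
      filter_upwards [(isOpen_univ.prod ho).mem_nhds hmem] with q hq
      obtain ⟨s, m'⟩ := q
      by_cases hr' : m' ∈ Set.range φ
      · obtain ⟨x, rfl⟩ := hr'
        rw [hF₁]
        refine (hfk s x ?_).symm
        by_contra! hlt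
        exact hq.2 ⟨x, mem_closedBall_zero_iff.2 hlt.le, rfl⟩
      · exact (hF₂ s m' hr').symm
  refine ⟨⟨fun q => F (q.1, q.2), ?_⟩, fun t x _ => hF₁ t x, fun t p => hF₂ t p⟩
  rw [continuous_iff_continuousAt]
  rintro ⟨t, p⟩
  exact ContinuousAt.comp (g := F) (x := (t, p))
    (f := fun q : T × ({φ 0}ᶜ : Set M) => (q.1, (q.2 : M)))
    (hcont t p p.2) (by fun_prop)

/-- A family of radial self-maps of a punctured manifold, supported in a chart. -/
theorem exists_radial [NormedSpace ℝ E] [ProperSpace E] {φ : E → M} (hφ : IsOpenEmbedding φ) {R : ℝ}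
    (ν : T → ℝ → ℝ) (hν : Continuous fun q : T × ℝ => ν q.1 q.2)
    (hpos : ∀ t r, 0 < r → 0 < ν t r) (hR : ∀ t r, R ≤ r → ν t r = r) :
    ∃ F : C(T × ({φ 0}ᶜ : Set M), ({φ 0}ᶜ : Set M)),
      (∀ t x hx, ∃ y, ‖y‖ = ν t ‖x‖ ∧ (F (t, ⟨φ x, hx⟩) : M) = φ y) ∧
      (∀ t x hx, ν t ‖x‖ = ‖x‖ → F (t, ⟨φ x, hx⟩) = ⟨φ x, hx⟩) ∧
      ∀ t (p : ({φ 0}ᶜ : Set M)), (p : M) ∉ Set.range φ → F (t, p) = p := by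
  have hone : ∀ t (x : E), ν t ‖x‖ = ‖x‖ → (ν t ‖x‖ / ‖x‖) • x = x := by
    intro t x h
    rcases eq_or_ne x 0 with rfl | hx
    · simp
    · rw [h, div_self (norm_ne_zero_iff.2 hx), one_smul]
  obtain ⟨F, hF₁, hF₂⟩ := exists_glue_punctured (R := R) (T := T) hφ
    (f := fun q => φ ((ν q.1 ‖q.2‖ / ‖q.2‖) • q.2)) (by
      intro t x hx
      refine hφ.continuous.continuousAt.comp ?_
      refine ContinuousAt.smul (ContinuousAt.div ?_ (by fun_prop) (norm_ne_zero_iff.2 hx))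
        (by fun_prop)
      exact (hν.comp (by fun_prop : Continuous fun q : T × E => (q.1, ‖q.2‖))).continuousAt)
    ⟨Prod.snd, continuous_snd⟩ (by
      intro t x hx
      simp [hone t x (hR t _ hx)])
  have hnorm : ∀ t x, φ x ∈ ({φ 0}ᶜ : Set M) → ‖(ν t ‖x‖ / ‖x‖) • x‖ = ν t ‖x‖ := by
    intro t x hx
    have hx0 : 0 < ‖x‖ := norm_pos_iff.2 fun h => hx (by rw [h]; rfl)
    rw [norm_smul, Real.norm_of_nonneg (by have := hpos t _ hx0; positivity),
      div_mul_cancel₀ _ hx0.ne']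
  have hFne : ∀ q, F q ∈ ({φ 0}ᶜ : Set M) := by
    rintro ⟨t, p, hp⟩ h
    by_cases hr : p ∈ Set.range φ
    · obtain ⟨x, rfl⟩ := hr
      rw [hF₁] at h
      have h0 := hφ.injective h
      have h1 := hnorm t x hp
      have hx0 : 0 < ‖x‖ := norm_pos_iff.2 fun h => hp (by rw [h]; rfl)
      have h2 := hpos t _ hx0
      simp only at h0
      rw [h0, norm_zero] at h1
      exact h2.ne h1
    · rw [hF₂ t ⟨p, hp⟩ hr] at h
      exact hp h
  refine ⟨⟨fun q => ⟨F q, hFne q⟩, by fun_prop⟩, ?_, ?_, ?_⟩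
  · intro t x hx
    exact ⟨_, hnorm t x hx, hF₁ t x hx⟩
  · intro t x hx h
    apply Subtype.ext
    change F _ = φ x
    rw [hF₁]
    simp only [hone t x h]
  · intro t p hp
    exact Subtype.ext (hF₂ t p hp)

end Radial

/-- A closed piece `C` of `N` with a collar of its intersection with `B` and a closed filtration
whose intermediate strata avoid the collar. -/
structure CollaredFiltration {N : Type*} [TopologicalSpace N] (C B : Set N) where
  τ : C(C, ℝ)
  G : C(I × C, C)
  Φ₀ : Set C
  Φ₁ : Set C
  Φ₂ : Set C
  nonneg : ∀ x : C, 0 ≤ τ x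
  eq_zero : ∀ x : C, τ x = 0 ↔ (x : N) ∈ B
  G_zero : ∀ x : C, G (0, x) = x
  G_fix : ∀ (s : I) (x : C), (x : N) ∈ B → G (s, x) = x
  G_one : ∀ x : C, τ x ≤ 1 → (G (1, x) : N) ∈ B
  closed₀ : IsClosed Φ₀
  closed₁ : IsClosed Φ₁
  closed₂ : IsClosed Φ₂
  subset₁ : Φ₀ ⊆ Φ₁
  subset₂ : Φ₁ ⊆ Φ₂
  one_lt : ∀ x ∈ Φ₂ \ Φ₀, 1 < τ x
  cat₀ : IsCategorical (ContinuousMap.id N) ((↑) '' Φ₀ \ B)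
  cat₁ : IsCategorical (ContinuousMap.id N) ((↑) '' (Φ₁ \ Φ₀) \ B)
  cat₂ : IsCategorical (ContinuousMap.id N) ((↑) '' (Φ₂ \ Φ₁) \ B)
  cat₃ : IsCategorical (ContinuousMap.id N) ((↑) '' Φ₂ᶜ \ B)

/-- Exchanging the two summands. -/
def ConnectedSumData.symm {n : ℕ} {N M₁ M₂ : Type} [TopologicalSpace N] [TopologicalSpace M₁]
    [TopologicalSpace M₂] (D : ConnectedSumData n N M₁ M₂) : ConnectedSumData n N M₂ M₁ where
  φ₁ := D.φ₂
  φ₂ := D.φ₁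
  emb₁ := D.emb₂
  emb₂ := D.emb₁
  C₁ := D.C₂
  C₂ := D.C₁
  closed₁ := D.closed₂
  closed₂ := D.closed₁
  cover := by rw [Set.union_comm, D.cover]
  h₁ := D.h₂
  h₂ := D.h₁
  inter₁ := D.inter₂
  inter₂ := D.inter₁

/-- The first piece of a connected sum is a retract of the punctured first summand. -/
theorem ConnectedSumData.exists_retraction {n : ℕ} {N M₁ M₂ : Type} [TopologicalSpace N]
    [TopologicalSpace M₁] [TopologicalSpace M₂] [T2Space M₁] (D : ConnectedSumData n N M₁ M₂) :
    ∃ (κ : C(D.C₁, ({D.φ₁ 0}ᶜ : Set M₁))) (q : C(({D.φ₁ 0}ᶜ : Set M₁), D.C₁)),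
      (∀ x, (κ x : M₁) = D.h₁ x) ∧ ∀ x, q (κ x) = x := by
  let K : Set M₁ := (D.φ₁ '' Metric.ball 0 1)ᶜ
  let P : Set M₁ := {D.φ₁ 0}ᶜ
  have hinj := D.emb₁.injective
  have hKP : ∀ m ∈ K, m ∈ P := by
    rintro _ hm rfl
    exact hm ⟨0, by simp, rfl⟩
  have hφK : ∀ x, D.φ₁ x ∈ K ↔ 1 ≤ ‖x‖ := by
    intro x
    simp only [K, Set.mem_compl_iff, hinj.mem_set_image, mem_ball_zero_iff, not_lt]
  let κ : C(D.C₁, P) := ⟨fun x => ⟨D.h₁ x, hKP _ (D.h₁ x).2⟩, by fun_prop⟩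
  obtain ⟨Q, hQ₁, hQ₂, hQ₃⟩ := exists_radial (T := Unit) (R := 1) D.emb₁
    (fun _ r => max r 1) (by fun_prop) (fun _ r hr => lt_max_of_lt_left hr)
    (fun _ r hr => max_eq_left hr)
  have hQK : ∀ p, (Q ((), p) : M₁) ∈ K := by
    rintro ⟨p, hp⟩
    by_cases hr : p ∈ Set.range D.φ₁
    · obtain ⟨x, rfl⟩ := hr
      obtain ⟨y, hy, hy'⟩ := hQ₁ () x hp
      rw [hy', hφK, hy]
      exact le_max_right _ _
    · rw [hQ₃ () ⟨p, hp⟩ hr]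
      rintro ⟨x, -, rfl⟩
      exact hr ⟨x, rfl⟩
  have hQid : ∀ p : P, (p : M₁) ∈ K → Q ((), p) = p := by
    rintro ⟨p, hp⟩ hpK
    by_cases hr : p ∈ Set.range D.φ₁
    · obtain ⟨x, rfl⟩ := hr
      exact hQ₂ () x hp (max_eq_left ((hφK x).1 hpK))
    · exact hQ₃ () _ hr
  let q : C(P, D.C₁) := ⟨fun p => D.h₁.symm ⟨Q ((), p), hQK p⟩, by fun_prop⟩
  have hq : ∀ x, q (κ x) = x := by
    intro x
    have : (⟨Q ((), κ x), hQK (κ x)⟩ : K) = D.h₁ x := by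
      have h' : (Q ((), κ x) : M₁) = κ x := congrArg Subtype.val (hQid (κ x) ((D.h₁ x).2))
      exact Subtype.ext h'
    exact D.h₁.symm_apply_eq.2 this
  exact ⟨κ, q, fun _ => rfl, hq⟩

theorem ConnectedSumData.nonempty_collaredFiltration {n : ℕ} {N M₁ M₂ : Type} [TopologicalSpace N]
    [TopologicalSpace M₁] [TopologicalSpace M₂] [T2Space M₁] (D : ConnectedSumData n N M₁ M₂)
    {F₀ F₁ F₂ : Set ({D.φ₁ 0}ᶜ : Set M₁)} (hF : IsCategoricalFiltration F₀ F₁ F₂)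
    {O : Set M₁} (hO : IsOpen O) (hφO : D.φ₁ 0 ∈ O) (hFO : ∀ p ∈ F₂ \ F₀, (p : M₁) ∉ O) :
    Nonempty (CollaredFiltration D.C₁ D.C₂) := by
  let K : Set M₁ := (D.φ₁ '' Metric.ball 0 1)ᶜ
  let P : Set M₁ := {D.φ₁ 0}ᶜ
  have hinj := D.emb₁.injective
  have hφK : ∀ x, D.φ₁ x ∈ K ↔ 1 ≤ ‖x‖ := by
    intro x
    simp only [K, Set.mem_compl_iff, hinj.mem_set_image, mem_ball_zero_iff, not_lt]
  obtain ⟨κ, q, hκ, hq⟩ := D.exists_retraction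
  have hκK : ∀ x, (κ x : M₁) ∈ K := fun x => hκ x ▸ (D.h₁ x).2
  have hC₂ : ∀ x : D.C₁, (x : N) ∈ D.C₂ ↔ (κ x : M₁) ∈ D.φ₁ '' Metric.sphere 0 1 := fun x => by
    rw [hκ, D.inter₁]
  -- compressing the chart into the neighbourhood of the puncture
  obtain ⟨η, hη, hηO⟩ := Metric.isOpen_iff.1 (hO.preimage D.emb₁.continuous) 0 hφO
  let δ : ℝ := min 1 (η / 3)
  have hδ : 0 < δ := lt_min one_pos (by positivity)
  obtain ⟨Ψ, hΨ₁, hΨ₂, hΨ₃⟩ := exists_radial (T := I) (R := 3) D.emb₁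
    (fun t r => (1 - t) * r + t * max (δ * r) (min r (3 * r - 6))) (by fun_prop)
    (by
      rintro ⟨t, ht0, ht1⟩ r hr
      have h1 : δ * r ≤ max (δ * r) (min r (3 * r - 6)) := le_max_left _ _
      have h2 : 0 < δ * r := by positivity
      change 0 < (1 - t) * r + t * max (δ * r) (min r (3 * r - 6))
      rcases ht0.eq_or_lt with rfl | ht
      · simpa using hr
      · have h3 : 0 < t * max (δ * r) (min r (3 * r - 6)) := mul_pos ht (h2.trans_le h1)
        have h4 : 0 ≤ (1 - t) * r := mul_nonneg (by linarith) hr.le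
        linarith)
    (by
      rintro ⟨t, ht0, ht1⟩ r hr
      have h1 : δ * r ≤ r := mul_le_of_le_one_left (by linarith) (min_le_left _ _)
      rw [min_eq_left (by linarith), max_eq_right h1]
      ring)
  let ψ : C(P, P) := ⟨fun p => Ψ (1, p), by fun_prop⟩
  have hψ : (ContinuousMap.id P).Homotopic ψ := by
    refine ⟨⟨Ψ, fun p => ?_, fun p => rfl⟩⟩
    by_cases hp : (p : M₁) ∈ Set.range D.φ₁
    · obtain ⟨p, hp'⟩ := p
      obtain ⟨x, rfl⟩ := hp
      exact hΨ₂ 0 x hp' (by simp)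
    · exact hΨ₃ 0 p hp
  have hF' := hF.preimage hψ
  have hψO : ∀ x hx, ‖x‖ ≤ 2 → (ψ ⟨D.φ₁ x, hx⟩ : M₁) ∈ O := by
    intro x hx hx2
    obtain ⟨y, hy, hy'⟩ := hΨ₁ 1 x hx
    change ((Ψ (1, ⟨D.φ₁ x, hx⟩) : P) : M₁) ∈ O
    rw [hy']
    apply hηO
    rw [mem_ball_zero_iff, hy]
    have h1 : δ ≤ η / 3 := min_le_right _ _
    have h2 : δ * ‖x‖ ≤ η / 3 * 2 := by gcongr
    have h3 : min ‖x‖ (3 * ‖x‖ - 6) ≤ 3 * ‖x‖ - 6 := min_le_right _ _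
    simp only [Set.Icc.coe_one, sub_self, zero_mul, one_mul, zero_add, max_lt_iff]
    constructor <;> linarith
  have hcat : ∀ {L : Set P}, IsCategorical (ContinuousMap.id P) L →
      IsCategorical (ContinuousMap.id N) ((↑) '' (κ ⁻¹' L) \ D.C₂) := by
    intro L hL
    have hsub : ∀ x ∈ D.C₂ᶜ, x ∈ D.C₁ := by
      intro x hx
      have : x ∈ D.C₁ ∪ D.C₂ := D.cover ▸ Set.mem_univ x
      exact this.resolve_right hx
    let inc : C((D.C₂ᶜ : Set N), D.C₁) := ⟨fun x => ⟨x, hsub x x.2⟩, by fun_prop⟩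
    let val₁ : C(D.C₁, N) := ⟨Subtype.val, continuous_subtype_val⟩
    let val₂ : C((D.C₂ᶜ : Set N), N) := ⟨Subtype.val, continuous_subtype_val⟩
    have h1 := (hL.comp_left (val₁.comp q)).comp_right (κ.comp inc)
    have h2 : ((val₁.comp q).comp (ContinuousMap.id P)).comp (κ.comp inc) =
        (ContinuousMap.id N).comp val₂ := by
      ext x
      change (q (κ (inc x)) : N) = x
      rw [hq]
      rfl
    rw [h2] at h1
    refine (IsCategorical.image (D.closed₂.isOpen_compl.isOpenEmbedding_subtypeVal) h1).mono ?_
    rintro _ ⟨⟨x, hx, rfl⟩, hxC⟩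
    exact ⟨⟨x, hxC⟩, hx, rfl⟩
  -- the homotopy collapsing the collar
  obtain ⟨Γ, hΓ₁, hΓ₂, hΓ₃⟩ := exists_radial (T := I) (R := 3) D.emb₁
    (fun t r => (1 - t) * r + t * max 1 (min r (2 * r - 3))) (by fun_prop)
    (by
      rintro ⟨t, ht0, ht1⟩ r hr
      have h1 : 1 ≤ max 1 (min r (2 * r - 3)) := le_max_left _ _
      change 0 < (1 - t) * r + t * max 1 (min r (2 * r - 3))
      rcases ht0.eq_or_lt with rfl | ht
      · simpa using hr
      · have h3 : 0 < t * max 1 (min r (2 * r - 3)) := by positivity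
        have h4 : 0 ≤ (1 - t) * r := mul_nonneg (by linarith) hr.le
        linarith)
    (by
      rintro ⟨t, ht0, ht1⟩ r hr
      rw [min_eq_left (by linarith), max_eq_right (by linarith)]
      ring)
  have hΓK : ∀ t (p : P), (p : M₁) ∈ K → (Γ (t, p) : M₁) ∈ K := by
    rintro t ⟨p, hp⟩ hpK
    by_cases hr : p ∈ Set.range D.φ₁
    · obtain ⟨x, rfl⟩ := hr
      obtain ⟨y, hy, hy'⟩ := hΓ₁ t x hp
      rw [hy', hφK, hy]
      have h1 := (hφK x).1 hpK
      have h2 : 1 ≤ max 1 (min ‖x‖ (2 * ‖x‖ - 3)) := le_max_left _ _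
      nlinarith [t.2.1, t.2.2]
    · rw [hΓ₃ t ⟨p, hp⟩ hr]
      exact hpK
  let G : C(I × D.C₁, D.C₁) :=
    ⟨fun z => D.h₁.symm ⟨Γ (z.1, κ z.2), hΓK _ _ (hκK _)⟩, by fun_prop⟩
  have hGκ : ∀ t x, (κ (G (t, x)) : M₁) = Γ (t, κ x) := by
    intro t x
    rw [hκ]
    change (D.h₁ (D.h₁.symm _) : M₁) = _
    rw [D.h₁.apply_symm_apply]
  have hGid : ∀ t x, Γ (t, κ x) = κ x → G (t, x) = x := by
    intro t x h
    have h' : (Γ (t, κ x) : M₁) = D.h₁ x := by rw [h, hκ]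
    have : (⟨Γ (t, κ x), hΓK _ _ (hκK _)⟩ : K) = D.h₁ x := Subtype.ext h'
    exact D.h₁.symm_apply_eq.2 this
  -- the collar coordinate
  obtain ⟨θ, hθ₁, hθ₂⟩ := exists_glue_punctured (T := Unit) (R := 4) D.emb₁
    (f := fun z => min ‖z.2‖ 4 - 1) (fun _ _ _ => by fun_prop) (ContinuousMap.const _ 3) (by
      intro t x hx
      simp only [ContinuousMap.const_apply, min_eq_right hx]
      norm_num)
  have hθκ : ∀ x : D.C₁, (∃ y hy, κ x = ⟨D.φ₁ y, hy⟩ ∧ 1 ≤ ‖y‖ ∧ θ ((), κ x) = min ‖y‖ 4 - 1) ∨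
      ((κ x : M₁) ∉ Set.range D.φ₁ ∧ θ ((), κ x) = 3) := by
    intro x
    by_cases hr : (κ x : M₁) ∈ Set.range D.φ₁
    · obtain ⟨y, hy⟩ := hr
      have hyP : D.φ₁ y ∈ P := hy ▸ (κ x).2
      have he : κ x = ⟨D.φ₁ y, hyP⟩ := Subtype.ext hy.symm
      refine Or.inl ⟨y, hyP, he, (hφK y).1 (hy ▸ hκK x), ?_⟩
      rw [he, hθ₁]
    · exact Or.inr ⟨hr, hθ₂ () _ hr⟩
  refine ⟨⟨⟨fun x => θ ((), κ x), by fun_prop⟩, G, κ ⁻¹' (ψ ⁻¹' F₀), κ ⁻¹' (ψ ⁻¹' F₁),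
    κ ⁻¹' (ψ ⁻¹' F₂), ?_, ?_, ?_, ?_, ?_, hF'.closed₀.preimage κ.continuous,
    hF'.closed₁.preimage κ.continuous, hF'.closed₂.preimage κ.continuous,
    Set.preimage_mono hF'.subset₁, Set.preimage_mono hF'.subset₂, ?_, hcat hF'.cat₀,
    hcat hF'.cat₁, hcat hF'.cat₂, hcat hF'.cat₃⟩⟩
  · intro x
    change 0 ≤ θ ((), κ x)
    rcases hθκ x with ⟨y, hy, -, hy1, h⟩ | ⟨-, h⟩
    · rw [h, sub_nonneg]
      exact le_min hy1 (by norm_num)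
    · rw [h]; norm_num
  · intro x
    change θ ((), κ x) = 0 ↔ _
    rw [hC₂]
    rcases hθκ x with ⟨y, hy, he, hy1, h⟩ | ⟨hr, h⟩
    · rw [h, he]
      simp only [hinj.mem_set_image, mem_sphere_zero_iff_norm]
      constructor
      · intro h
        rcases min_choice ‖y‖ 4 with h' | h' <;> linarith
      · intro h
        rw [h]
        norm_num
    · rw [h]
      refine ⟨fun h => by norm_num at h, ?_⟩
      rintro ⟨y, -, hy⟩
      exact absurd ⟨y, hy⟩ hr
  · intro x
    apply hGid
    rcases hθκ x with ⟨y, hy, he, hy1, h⟩ | ⟨hr, h⟩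
    · rw [he]
      exact hΓ₂ 0 y hy (by simp)
    · exact hΓ₃ 0 _ hr
  · intro t x hx
    apply hGid
    rw [hC₂] at hx
    rcases hθκ x with ⟨y, hy, he, hy1, h⟩ | ⟨hr, h⟩
    · rw [he] at hx ⊢
      have hy' : ‖y‖ = 1 := by simpa [hinj.mem_set_image] using hx
      refine hΓ₂ t y hy ?_
      rw [hy', max_eq_left]
      · ring
      · exact (min_le_right _ _).trans (by norm_num)
    · exact hΓ₃ t _ hr
  · intro x hx
    change θ ((), κ x) ≤ 1 at hx
    rw [hC₂, hGκ]
    rcases hθκ x with ⟨y, hy, he, hy1, h⟩ | ⟨hr, h⟩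
    · have hy2 : ‖y‖ ≤ 2 := by
        rcases min_choice ‖y‖ 4 with h' | h' <;> linarith
      obtain ⟨z, hz, hz'⟩ := hΓ₁ 1 y hy
      rw [he, hz']
      refine ⟨z, ?_, rfl⟩
      rw [mem_sphere_zero_iff_norm, hz, max_eq_left]
      · simp
      · exact (min_le_right _ _).trans (by linarith)
    · linarith
  · rintro x hx
    change 1 < θ ((), κ x)
    by_contra! hle
    rcases hθκ x with ⟨y, hy, he, hy1, h⟩ | ⟨hr, h⟩
    · have hy2 : ‖y‖ ≤ 2 := by
        rcases min_choice ‖y‖ 4 with h' | h' <;> linarith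
      refine hFO (ψ (κ x)) hx ?_
      rw [he]
      exact hψO y hy hy2
    · linarith

section ClosedCover

variable {T N Z : Type*} [TopologicalSpace T] [TopologicalSpace N] [TopologicalSpace Z]
  {C₁ C₂ : Set N}

/-- Gluing families of maps along a closed cover. -/
theorem exists_glue_closed (h₁ : IsClosed C₁) (h₂ : IsClosed C₂) (hC : C₁ ∪ C₂ = Set.univ)
    (f₁ : C(T × C₁, Z)) (f₂ : C(T × C₂, Z))
    (h : ∀ t x hx₁ hx₂, f₁ (t, ⟨x, hx₁⟩) = f₂ (t, ⟨x, hx₂⟩)) :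
    ∃ F : C(T × N, Z), (∀ t (x : C₁), F (t, x) = f₁ (t, x)) ∧
      ∀ t (x : C₂), F (t, x) = f₂ (t, x) := by
  classical
  have hmem : ∀ x, x ∉ C₁ → x ∈ C₂ := fun x hx =>
    (hC ▸ Set.mem_univ x : x ∈ C₁ ∪ C₂).resolve_left hx
  let F : T × N → Z := fun q =>
    if hq : q.2 ∈ C₁ then f₁ (q.1, ⟨q.2, hq⟩) else f₂ (q.1, ⟨q.2, hmem _ hq⟩)
  have hF₁ : ∀ t (x : C₁), F (t, x) = f₁ (t, x) := fun t x => dif_pos x.2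
  have hF₂ : ∀ t (x : C₂), F (t, x) = f₂ (t, x) := by
    intro t x
    by_cases hx : (x : N) ∈ C₁
    · exact (dif_pos hx).trans (h t x hx x.2)
    · exact dif_neg hx
  have hcont : ContinuousOn F (Prod.snd ⁻¹' C₁ ∪ Prod.snd ⁻¹' C₂) := by
    refine ContinuousOn.union_of_isClosed ?_ ?_ (h₁.preimage continuous_snd)
      (h₂.preimage continuous_snd)
    · rw [continuousOn_iff_continuous_domRestrict]
      have : Continuous fun q : (Prod.snd ⁻¹' C₁ : Set (T × N)) => f₁ (q.1.1, ⟨q.1.2, q.2⟩) := by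
        fun_prop
      exact this.congr fun q => (hF₁ q.1.1 ⟨q.1.2, q.2⟩).symm
    · rw [continuousOn_iff_continuous_domRestrict]
      have : Continuous fun q : (Prod.snd ⁻¹' C₂ : Set (T × N)) => f₂ (q.1.1, ⟨q.1.2, q.2⟩) := by
        fun_prop
      exact this.congr fun q => (hF₂ q.1.1 ⟨q.1.2, q.2⟩).symm
  rw [← Set.preimage_union, hC, Set.preimage_univ, continuousOn_univ] at hcont
  exact ⟨⟨F, hcont⟩, hF₁, hF₂⟩

theorem compactSpace_of_closed_cover [CompactSpace C₁] [CompactSpace C₂]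
    (hC : C₁ ∪ C₂ = Set.univ) : CompactSpace N :=
  ⟨hC ▸ (isCompact_iff_compactSpace.2 ‹_›).union (isCompact_iff_compactSpace.2 ‹_›)⟩

theorem t2Space_of_closed_cover [T2Space C₁] [T2Space C₂] (h₁ : IsClosed C₁) (h₂ : IsClosed C₂)
    (hC : C₁ ∪ C₂ = Set.univ) : T2Space N := by
  have key : ∀ {C : Set N} [T2Space C], IsClosed C →
      IsClosed {q : N × N | q.1 ∈ C ∧ q.1 = q.2} := by
    intro C _ hc
    have := (hc.isClosedEmbedding_subtypeVal.prodMap hc.isClosedEmbedding_subtypeVal).isClosedMap _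
      (isClosed_diagonal (X := C))
    convert this using 1
    ext ⟨x, y⟩
    constructor
    · rintro ⟨hx, rfl : x = y⟩
      exact ⟨(⟨x, hx⟩, ⟨x, hx⟩), rfl, rfl⟩
    · rintro ⟨⟨a, b⟩, rfl : a = b, hab⟩
      rw [← hab]
      exact ⟨a.2, rfl⟩
  rw [t2_iff_isClosed_diagonal]
  convert (key h₁).union (key h₂) using 1
  ext ⟨x, y⟩
  have : x ∈ C₁ ∪ C₂ := hC ▸ Set.mem_univ x
  simp only [Set.mem_diagonal_iff, Set.mem_union, Set.mem_ofPred_eq]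
  rw [← or_and_right]
  exact ⟨fun h => ⟨this, h⟩, And.right⟩

theorem metrizableSpace_of_closed_cover [CompactSpace C₁] [CompactSpace C₂] [T2Space C₁]
    [T2Space C₂] [SecondCountableTopology C₁] [SecondCountableTopology C₂] (h₁ : IsClosed C₁)
    (h₂ : IsClosed C₂) (hC : C₁ ∪ C₂ = Set.univ) (t : C(N, ℝ)) (ht₁ : ∀ x, x ∈ C₁ ↔ 0 ≤ t x)
    (ht₂ : ∀ x, x ∈ C₂ ↔ t x ≤ 0) : TopologicalSpace.MetrizableSpace N := by
  have : CompactSpace N := compactSpace_of_closed_cover hC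
  have : T2Space N := t2Space_of_closed_cover h₁ h₂ hC
  have key : ∀ {C : Set N} [T3Space C] [SecondCountableTopology C], IsClosed C →
      ∃ E : C(N, ℕ → ℝ), Set.InjOn E C := by
    intro C _ _ hC
    obtain ⟨f, hf⟩ := TopologicalSpace.exists_embedding_l_infty C
    let f' : C(C, ℕ → ℝ) := ⟨fun x n => f x n, continuous_pi fun n =>
      (continuous_eval_const n).comp hf.continuous⟩
    obtain ⟨E, hE⟩ := f'.exists_restrict_eq hC
    refine ⟨E, fun x hx y hy hxy => ?_⟩
    have h1 : E x = f' ⟨x, hx⟩ := congrArg (fun g => g ⟨x, hx⟩) hE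
    have h2 : E y = f' ⟨y, hy⟩ := congrArg (fun g => g ⟨y, hy⟩) hE
    have h3 : f ⟨x, hx⟩ = f ⟨y, hy⟩ := by
      ext n
      exact congrFun (h1.symm.trans (hxy.trans h2)) n
    exact congrArg Subtype.val (hf.injective h3)
  obtain ⟨E₁, hE₁⟩ := key h₁
  obtain ⟨E₂, hE₂⟩ := key h₂
  have hinj : Function.Injective fun x => (t x, E₁ x, E₂ x) := by
    intro x y hxy
    simp only [Prod.mk.injEq] at hxy
    obtain ⟨h0, h1, h2⟩ := hxy
    rcases le_total 0 (t x) with h | h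
    · exact hE₁ ((ht₁ x).2 h) ((ht₁ y).2 (h0 ▸ h)) h1
    · exact hE₂ ((ht₂ x).2 h) ((ht₂ y).2 (h0 ▸ h)) h2
  exact ((Continuous.isClosedEmbedding (by fun_prop) hinj).isEmbedding).metrizableSpace

end ClosedCover

namespace CollaredFiltration

variable {N : Type*} [TopologicalSpace N] {C₁ C₂ : Set N}

theorem exists_signed (c₁ : CollaredFiltration C₁ C₂) (c₂ : CollaredFiltration C₂ C₁)
    (h₁ : IsClosed C₁) (h₂ : IsClosed C₂) (hC : C₁ ∪ C₂ = Set.univ) :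
    ∃ t : C(N, ℝ), (∀ x : C₁, t x = c₁.τ x) ∧ (∀ x : C₂, t x = - c₂.τ x) ∧
      (∀ x, x ∈ C₁ ↔ 0 ≤ t x) ∧ ∀ x, x ∈ C₂ ↔ t x ≤ 0 := by
  obtain ⟨F, hF₁, hF₂⟩ := exists_glue_closed (T := Unit) h₁ h₂ hC
    (c₁.τ.comp ContinuousMap.snd) ((-c₂.τ).comp ContinuousMap.snd) (by
      intro _ x hx₁ hx₂
      have e₁ := (c₁.eq_zero ⟨x, hx₁⟩).2 hx₂
      have e₂ := (c₂.eq_zero ⟨x, hx₂⟩).2 hx₁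
      simp [e₁, e₂])
  let t : C(N, ℝ) := ⟨fun x => F ((), x), by fun_prop⟩
  have ht₁ : ∀ x : C₁, t x = c₁.τ x := fun x => hF₁ () x
  have ht₂ : ∀ x : C₂, t x = - c₂.τ x := fun x => hF₂ () x
  have hcov : ∀ x, x ∈ C₁ ∨ x ∈ C₂ := fun x => (hC ▸ Set.mem_univ x : x ∈ C₁ ∪ C₂)
  have hpos : ∀ x ∈ C₁, 0 ≤ t x := fun x hx => (ht₁ ⟨x, hx⟩).symm ▸ c₁.nonneg ⟨x, hx⟩
  have hneg : ∀ x ∈ C₂, t x ≤ 0 := by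
    intro x hx
    rw [ht₂ ⟨x, hx⟩]
    exact neg_nonpos.2 (c₂.nonneg ⟨x, hx⟩)
  refine ⟨t, ht₁, ht₂, fun x => ⟨hpos x, fun h => ?_⟩, fun x => ⟨hneg x, fun h => ?_⟩⟩
  · rcases hcov x with hx | hx
    · exact hx
    · refine (c₂.eq_zero ⟨x, hx⟩).1 ?_
      have := ht₂ ⟨x, hx⟩
      have := hneg x hx
      simp only at *
      linarith
  · rcases hcov x with hx | hx
    · refine (c₁.eq_zero ⟨x, hx⟩).1 ?_
      have := ht₁ ⟨x, hx⟩
      have := hpos x hx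
      simp only at *
      linarith
    · exact hx

theorem exists_collapse (c₁ : CollaredFiltration C₁ C₂) (c₂ : CollaredFiltration C₂ C₁)
    (h₁ : IsClosed C₁) (h₂ : IsClosed C₂) (hC : C₁ ∪ C₂ = Set.univ) :
    ∃ g : C(N, N), (ContinuousMap.id N).Homotopic g ∧
      (∀ x : C₁, c₁.τ x ≤ 1 → g x ∈ C₁ ∩ C₂) ∧ ∀ x : C₂, c₂.τ x ≤ 1 → g x ∈ C₁ ∩ C₂ := by
  let v₁ : C(C₁, N) := ⟨Subtype.val, continuous_subtype_val⟩
  let v₂ : C(C₂, N) := ⟨Subtype.val, continuous_subtype_val⟩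
  obtain ⟨F, hF₁, hF₂⟩ := exists_glue_closed h₁ h₂ hC (v₁.comp c₁.G) (v₂.comp c₂.G) (by
    intro s x hx₁ hx₂
    change (c₁.G (s, ⟨x, hx₁⟩) : N) = c₂.G (s, ⟨x, hx₂⟩)
    rw [c₁.G_fix s ⟨x, hx₁⟩ hx₂, c₂.G_fix s ⟨x, hx₂⟩ hx₁])
  refine ⟨⟨fun x => F (1, x), by fun_prop⟩, ⟨⟨F, fun x => ?_, fun x => rfl⟩⟩, ?_, ?_⟩
  · rcases (hC ▸ Set.mem_univ x : x ∈ C₁ ∪ C₂) with hx | hx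
    · exact (hF₁ 0 ⟨x, hx⟩).trans (congrArg Subtype.val (c₁.G_zero ⟨x, hx⟩))
    · exact (hF₂ 0 ⟨x, hx⟩).trans (congrArg Subtype.val (c₂.G_zero ⟨x, hx⟩))
  · intro x hx
    have : F (1, x) = (c₁.G (1, x) : N) := hF₁ 1 x
    change F (1, x) ∈ _
    rw [this]
    exact ⟨(c₁.G (1, x)).2, c₁.G_one x hx⟩
  · intro x hx
    have : F (1, x) = (c₂.G (1, x) : N) := hF₂ 1 x
    change F (1, x) ∈ _
    rw [this]
    exact ⟨c₂.G_one x hx, (c₂.G (1, x)).2⟩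

theorem isCategorical_of_factor_embedding {S : Type*} [TopologicalSpace S] {k : S → N}
    (hk : IsClosedEmbedding k) {g : C(N, N)} (hg : (ContinuousMap.id N).Homotopic g) {O : Set N}
    (hO : IsOpen O) (hgO : ∀ x ∈ O, g x ∈ Set.range k) {v : S} [T1Space S]
    [ContractibleSpace ({v}ᶜ : Set S)] :
    IsCategorical (ContinuousMap.id N) {x | x ∈ O ∧ g x ≠ k v} := by
  have hcl : IsClosed {k v} := by
    simpa using hk.isClosedMap _ (isClosed_singleton (x := v))
  refine IsCategorical.of_homotopic (f := g) ⟨_, hO.inter (hcl.preimage g.continuous).isOpen_compl,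
    fun x hx => hx, ?_⟩ hg
  let e := hk.isEmbedding.toHomeomorph
  have he : ∀ y, k (e.symm y) = y := fun y => congrArg Subtype.val (e.apply_symm_apply y)
  let kᵥ : C(({v}ᶜ : Set S), N) := ⟨fun s => k s, hk.continuous.comp continuous_subtype_val⟩
  let U : Set N := O ∩ (g ⁻¹' {k v})ᶜ
  let ω : C(U, ({v}ᶜ : Set S)) := ⟨fun x => ⟨e.symm ⟨g x, hgO x x.2.1⟩, by
    intro h
    refine x.2.2 ?_
    have h' : e.symm ⟨g x, hgO x x.2.1⟩ = v := h
    change g x = k v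
    rw [← h', he]⟩, by fun_prop⟩
  have : g.restrict U = kᵥ.comp ω := by
    ext x
    exact (he ⟨g x, hgO x x.2.1⟩).symm
  rw [this]
  exact .of_factor kᵥ ω

/-- Two collared filtrations glue to a categorical filtration, with the tube around the
intersection decomposed into two strata. -/
theorem exists_isCategoricalFiltration (c₁ : CollaredFiltration C₁ C₂)
    (c₂ : CollaredFiltration C₂ C₁) (h₁ : IsClosed C₁) (h₂ : IsClosed C₂)
    (hC : C₁ ∪ C₂ = Set.univ) {S : Type*} [TopologicalSpace S] [T1Space S] {k : S → N}
    (hk : IsEmbedding k) (hkC : Set.range k = C₁ ∩ C₂) {v v' : S} (hv : v ≠ v')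
    [ContractibleSpace ({v}ᶜ : Set S)] [ContractibleSpace ({v'}ᶜ : Set S)] :
    ∃ F₀ F₁ F₂ : Set N, IsCategoricalFiltration F₀ F₁ F₂ := by
  obtain ⟨t, ht₁, ht₂, hC₁, hC₂⟩ := exists_signed c₁ c₂ h₁ h₂ hC
  obtain ⟨g, hg, hg₁, hg₂⟩ := exists_collapse c₁ c₂ h₁ h₂ hC
  have hkc : IsClosedEmbedding k := ⟨hk, hkC ▸ h₁.inter h₂⟩
  have hgr : ∀ x, |t x| < 1 → g x ∈ Set.range k := by
    intro x hx
    rw [hkC]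
    rcases le_total 0 (t x) with h | h
    · have hx₁ := (hC₁ x).2 h
      refine hg₁ ⟨x, hx₁⟩ ?_
      rw [← ht₁]
      exact (abs_lt.1 hx).2.le
    · have hx₂ := (hC₂ x).2 h
      refine hg₂ ⟨x, hx₂⟩ ?_
      have := ht₂ ⟨x, hx₂⟩
      have := (abs_lt.1 hx).1
      simp only at *
      linarith
  have hO : IsOpen {x | |t x| < 1} := isOpen_lt (by fun_prop) continuous_const
  have htube' := isCategorical_of_factor_embedding hkc hg hO hgr (v := v')
  have htube := isCategorical_of_factor_embedding hkc hg hO hgr (v := v)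
  -- the union of corresponding sets on the two sides, away from the tube
  let A : Set C₁ → Set C₂ → Set N := fun Φ Φ' =>
    ((↑) '' Φ ∩ {x | 1 / 2 ≤ t x}) ∪ ((↑) '' Φ' ∩ {x | t x ≤ -(1 / 2)})
  have hA : ∀ {Φ : Set C₁} {Φ' : Set C₂}, IsClosed Φ → IsClosed Φ' → IsClosed (A Φ Φ') := by
    intro Φ Φ' hΦ hΦ'
    exact ((h₁.isClosedEmbedding_subtypeVal.isClosedMap _ hΦ).inter
      (isClosed_le continuous_const (by fun_prop))).union
      ((h₂.isClosedEmbedding_subtypeVal.isClosedMap _ hΦ').inter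
      (isClosed_le (by fun_prop) continuous_const))
  have hAcat : ∀ {Φ : Set C₁} {Φ' : Set C₂},
      IsCategorical (ContinuousMap.id N) ((↑) '' Φ \ C₂) →
      IsCategorical (ContinuousMap.id N) ((↑) '' Φ' \ C₁) →
      IsCategorical (ContinuousMap.id N) (A Φ Φ') := by
    intro Φ Φ' hΦ hΦ'
    refine IsCategorical.union (O := {x | 0 < t x}) (O' := {x | t x < 0}) (hΦ.mono ?_)
      (hΦ'.mono ?_) (isOpen_lt continuous_const (by fun_prop))
      (isOpen_lt (by fun_prop) continuous_const) ?_ ?_ ?_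
    · rintro x ⟨hx, hx' : 1 / 2 ≤ t x⟩
      exact ⟨hx, fun h => by linarith [(hC₂ x).1 h]⟩
    · rintro x ⟨hx, hx' : t x ≤ -(1 / 2)⟩
      exact ⟨hx, fun h => by linarith [(hC₁ x).1 h]⟩
    · rintro x ⟨hx, hx' : 1 / 2 ≤ t x⟩
      exact lt_of_lt_of_le (by norm_num) hx'
    · rintro x ⟨hx, hx' : t x ≤ -(1 / 2)⟩
      exact lt_of_le_of_lt hx' (by norm_num)
    · exact Set.disjoint_left.2 fun x (hx : 0 < t x) (hx' : t x < 0) => lt_asymm hx hx'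
  have hAmono : ∀ {Φ Ψ : Set C₁} {Φ' Ψ' : Set C₂}, Φ ⊆ Ψ → Φ' ⊆ Ψ' → A Φ Φ' ⊆ A Ψ Ψ' :=
    fun h h' => Set.union_subset_union (Set.inter_subset_inter_left _ (Set.image_mono h))
      (Set.inter_subset_inter_left _ (Set.image_mono h'))
  have hAdiff : ∀ {Φ Ψ : Set C₁} {Φ' Ψ' : Set C₂}, A Φ Φ' \ A Ψ Ψ' ⊆ A (Φ \ Ψ) (Φ' \ Ψ') := by
    rintro Φ Ψ Φ' Ψ' x ⟨⟨⟨x, hx, rfl⟩, ht⟩ | ⟨⟨x, hx, rfl⟩, ht⟩, hn⟩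
    · exact Or.inl ⟨⟨x, ⟨hx, fun h => hn (Or.inl ⟨⟨x, h, rfl⟩, ht⟩)⟩, rfl⟩, ht⟩
    · exact Or.inr ⟨⟨x, ⟨hx, fun h => hn (Or.inr ⟨⟨x, h, rfl⟩, ht⟩)⟩, rfl⟩, ht⟩
  have hAfar : ∀ {Φ : Set C₁} {Φ' : Set C₂}, (∀ x ∈ Φ, 1 < c₁.τ x) → (∀ x ∈ Φ', 1 < c₂.τ x) →
      A Φ Φ' ⊆ {x | 3 / 4 < |t x|} := by
    rintro Φ Φ' hΦ hΦ' _ (⟨⟨x, hx, rfl⟩, -⟩ | ⟨⟨x, hx, rfl⟩, -⟩)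
    · have := hΦ x hx
      change 3 / 4 < |t x|
      rw [ht₁, abs_of_pos (by linarith)]
      linarith
    · have := hΦ' x hx
      change 3 / 4 < |t x|
      rw [ht₂, abs_neg, abs_of_pos (by linarith)]
      linarith
  have hunion : ∀ {B D : Set N}, IsCategorical (ContinuousMap.id N) B →
      IsCategorical (ContinuousMap.id N) D → B ⊆ {x | 3 / 4 < |t x|} → D ⊆ {x | |t x| < 3 / 4} →
      IsCategorical (ContinuousMap.id N) (B ∪ D) := by
    intro B D hB hD hB' hD'
    refine hB.union hD (isOpen_lt continuous_const (by fun_prop))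
      (isOpen_lt (by fun_prop) continuous_const) hB' hD' ?_
    exact Set.disjoint_left.2 fun x (hx : 3 / 4 < |t x|) (hx' : |t x| < 3 / 4) => lt_asymm hx hx'
  let T : Set N := {x | |t x| ≤ 1 / 2}
  have hT : IsClosed T := isClosed_le (by fun_prop) continuous_const
  let T' : Set N := T ∩ g ⁻¹' {k v}
  have hT' : IsClosed T' := by
    refine hT.inter (IsClosed.preimage g.continuous ?_)
    simpa using hkc.isClosedMap _ (isClosed_singleton (x := v))
  have hTlt : T ⊆ {x | |t x| < 3 / 4} := fun x (hx : |t x| ≤ 1 / 2) =>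
    lt_of_le_of_lt hx (by norm_num)
  have hTlt' : ∀ x ∈ T, |t x| < 1 := fun x (hx : |t x| ≤ 1 / 2) =>
    lt_of_le_of_lt hx (by norm_num)
  refine ⟨A c₁.Φ₀ c₂.Φ₀, A c₁.Φ₁ c₂.Φ₁ ∪ T', A c₁.Φ₂ c₂.Φ₂ ∪ T, hA c₁.closed₀ c₂.closed₀,
    (hA c₁.closed₁ c₂.closed₁).union hT', (hA c₁.closed₂ c₂.closed₂).union hT,
    (hAmono c₁.subset₁ c₂.subset₁).trans Set.subset_union_left,
    Set.union_subset_union (hAmono c₁.subset₂ c₂.subset₂) Set.inter_subset_left,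
    hAcat c₁.cat₀ c₂.cat₀, ?_, ?_, ?_⟩
  · refine (hunion (hAcat c₁.cat₁ c₂.cat₁) (htube'.mono (A := T') ?_) (hAfar ?_ ?_)
      (Set.inter_subset_left.trans hTlt)).mono ?_
    · rintro x ⟨hx, hx' : g x = k v⟩
      exact ⟨hTlt' x hx, fun h => hv (hk.injective (hx'.symm.trans h))⟩
    · exact fun x hx => c₁.one_lt x ⟨c₁.subset₂ hx.1, hx.2⟩
    · exact fun x hx => c₂.one_lt x ⟨c₂.subset₂ hx.1, hx.2⟩
    · rintro x ⟨hx | hx, hn⟩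
      · exact Or.inl (hAdiff ⟨hx, hn⟩)
      · exact Or.inr hx
  · refine (hunion (hAcat c₁.cat₂ c₂.cat₂) (htube.mono (A := T \ g ⁻¹' {k v}) ?_) (hAfar ?_ ?_)
      (Set.sdiff_subset.trans hTlt)).mono ?_
    · rintro x ⟨hx, hx'⟩
      exact ⟨hTlt' x hx, hx'⟩
    · exact fun x hx => c₁.one_lt x ⟨hx.1, fun h => hx.2 (c₁.subset₁ h)⟩
    · exact fun x hx => c₂.one_lt x ⟨hx.1, fun h => hx.2 (c₂.subset₁ h)⟩
    · rintro x ⟨hx | hx, hn⟩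
      · exact Or.inl (hAdiff ⟨hx, fun h => hn (Or.inl h)⟩)
      · exact Or.inr ⟨hx, fun h => hn (Or.inr ⟨hx, h⟩)⟩
  · refine (hAcat c₁.cat₃ c₂.cat₃).mono fun x hx => ?_
    have hxT : 1 / 2 < |t x| := not_le.1 fun h => hx (Or.inr h)
    rcases lt_abs.1 hxT with h | h
    · have hx₁ := (hC₁ x).2 (by linarith)
      exact Or.inl ⟨⟨⟨x, hx₁⟩, fun h' => hx (Or.inl (Or.inl ⟨⟨_, h', rfl⟩, h.le⟩)), rfl⟩, h.le⟩
    · have hx₂ := (hC₂ x).2 (by linarith)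
      have h' : t x ≤ -(1 / 2) := by linarith
      exact Or.inr ⟨⟨⟨x, hx₂⟩, fun h'' => hx (Or.inl (Or.inr ⟨⟨_, h'', rfl⟩, h'⟩)), rfl⟩, h'⟩

end CollaredFiltration

section MotionPlanning

variable {X : Type} [TopologicalSpace X]

/-- A locally nullhomotopic open subset of `X × X` carries a motion planner. -/
theorem LocallyNullhomotopic.exists_motionPlanner [PathConnectedSpace X] {U : Set (X × X)}
    (h : LocallyNullhomotopic ((ContinuousMap.id (X × X)).restrict U)) :
    ∃ s : C(U, C(I, X)), ∀ p : U, (s p) 0 = (p : X × X).1 ∧ (s p) 1 = (p : X × X).2 := by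
  obtain ⟨g, hg, ⟨H⟩⟩ := h
  let γ : ∀ q : X × X, Path q.1 q.2 := fun q => PathConnectedSpace.somePath q.1 q.2
  let P₁ : ∀ p : U, Path (p : X × X).1 (g p).1 := fun p => (H.evalAt p).map continuous_fst
  let P₂ : ∀ p : U, Path (p : X × X).2 (g p).2 := fun p => (H.evalAt p).map continuous_snd
  have hH : Continuous fun z : U × I => H (z.2, z.1) := by fun_prop
  have hP₁ : Continuous fun z : U × I => P₁ z.1 z.2 := continuous_fst.comp hH
  have hP₂ : Continuous fun z : U × I => P₂ z.1 z.2 := continuous_snd.comp hH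
  have hγ : Continuous fun z : U × I => γ (g z.1) z.2 := by
    rw [continuous_iff_continuousAt]
    rintro ⟨p, r⟩
    refine ContinuousAt.congr (f := fun z : U × I => γ (g p) z.2)
      (by fun_prop) ?_
    filter_upwards [(hg.isOpen_fiber (g p)).preimage continuous_fst |>.mem_nhds
      (show (p, r) ∈ Prod.fst ⁻¹' {x | g x = g p} from rfl)] with z hz
    have hz' : g z.1 = g p := hz
    rw [hz']
  let P : ∀ p : U, Path (p : X × X).1 (p : X × X).2 := fun p =>
    ((P₁ p).trans (γ (g p))).trans (P₂ p).symm
  have hP₁₂ : Continuous fun z : U × I => ((P₁ z.1).trans (γ (g z.1))) z.2 :=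
    Path.trans_continuous_family P₁ hP₁ (fun p => γ (g p)) hγ
  have hP : Continuous fun z : U × I => P z.1 z.2 :=
    Path.trans_continuous_family (fun p => (P₁ p).trans (γ (g p))) hP₁₂ (fun p => (P₂ p).symm)
      (Path.symm_continuous_family P₂ hP₂)
  exact ⟨(⟨fun z => P z.1 z.2, hP⟩ : C(U × I, X)).curry,
    fun p => ⟨(P p).source, (P p).target⟩⟩

/-- A categorical filtration with four strata yields a motion planner with seven rules. -/
theorem IsCategoricalFiltration.tcCoverable [PathConnectedSpace X]
    [CompletelyNormalSpace (X × X)] {F₀ F₁ F₂ : Set X} (h : IsCategoricalFiltration F₀ F₁ F₂) :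
    TCCoverable X 7 := by
  let F : ℕ → Set X := fun i => match i with
    | 0 => F₀
    | 1 => F₁
    | 2 => F₂
    | _ => Set.univ
  let L : ℕ → Set X := fun i => match i with
    | 0 => F₀
    | 1 => F₁ \ F₀
    | 2 => F₂ \ F₁
    | 3 => F₂ᶜ
    | _ => ∅
  have hF : ∀ i, IsClosed (F i) := by
    rintro (_ | _ | _ | _)
    exacts [h.closed₀, h.closed₁, h.closed₂, isClosed_univ]
  have hLF : ∀ i, L i ⊆ F i := by
    rintro (_ | _ | _ | _)
    exacts [le_rfl, Set.sdiff_subset, Set.sdiff_subset, Set.subset_univ _]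
  have hcat : ∀ i, IsCategorical (ContinuousMap.id X) (L i) := by
    rintro (_ | _ | _ | _ | _)
    exacts [h.cat₀, h.cat₁, h.cat₂, h.cat₃, .empty _]
  have hdisj : ∀ i j, i < j → Disjoint (F i) (L j) := by
    intro i j hij
    rw [Set.disjoint_left]
    intro x hx hx'
    match i, j with
    | 0, 1 => exact hx'.2 hx
    | 0, 2 => exact hx'.2 (h.subset₁ hx)
    | 0, 3 => exact hx' (h.subset₂ (h.subset₁ hx))
    | 1, 2 => exact hx'.2 hx
    | 1, 3 => exact hx' (h.subset₂ hx)
    | 2, 3 => exact hx' hx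
    | _, (n + 4) => exact hx'
    | (n + 3), 3 => omega
    | (n + 3), 2 => omega
    | (n + 3), 1 => omega
    | (n + 2), 2 => omega
    | (n + 2), 1 => omega
    | (n + 1), 1 => omega
    | n, 0 => omega
  have hex : ∀ x, ∃ i < 4, x ∈ L i := by
    intro x
    by_cases h0 : x ∈ F₀
    · exact ⟨0, by norm_num, h0⟩
    by_cases h1 : x ∈ F₁
    · exact ⟨1, by norm_num, h1, h0⟩
    by_cases h2 : x ∈ F₂
    · exact ⟨2, by norm_num, h2, h1⟩
    · exact ⟨3, by norm_num, h2⟩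
  have hW : ∀ m : ℕ, IsCategorical (ContinuousMap.id (X × X))
      (⋃ q ∈ Finset.HasAntidiagonal.antidiagonal m, L q.1 ×ˢ L q.2) := by
    intro m
    refine IsCategorical.biUnion_of_separated _ (fun q _ => (hcat q.1).prodMap (hcat q.2)) ?_
    rintro ⟨i, j⟩ hq ⟨i', j'⟩ hq' hne
    rw [Finset.HasAntidiagonal.mem_antidiagonal] at hq hq'
    have hsub : closure (L i ×ˢ L j) ⊆ F i ×ˢ F j :=
      closure_minimal (Set.prod_mono (hLF i) (hLF j)) ((hF i).prod (hF j))
    refine Disjoint.mono_left hsub ?_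
    rcases lt_trichotomy i i' with hi | rfl | hi
    · exact Set.Disjoint.set_prod_left (hdisj i i' hi) _ _
    · exact absurd (by simp only at hq hq' ⊢; congr; omega) hne
    · exact Set.Disjoint.set_prod_right (hdisj j j' (by simp only at hq hq'; omega)) _ _
  choose U hU hWU hnull using hW
  refine ⟨fun i => U i, fun i => hU i, ?_, fun i => (hnull i).exists_motionPlanner⟩
  rw [Set.eq_univ_iff_forall]
  rintro ⟨x, y⟩
  obtain ⟨i, hi, hx⟩ := hex x
  obtain ⟨j, hj, hy⟩ := hex y
  refine Set.mem_iUnion.2 ⟨⟨i + j, by omega⟩, hWU (i + j) ?_⟩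
  exact Set.mem_biUnion (x := (i, j)) (by simp) ⟨hx, hy⟩

end MotionPlanning

/-- A connected locally Euclidean space is path connected. -/
theorem IsLocallyEuclidean.pathConnectedSpace {n : ℕ} {X : Type} [TopologicalSpace X]
    [ConnectedSpace X] (h : IsLocallyEuclidean n X) : PathConnectedSpace X := by
  have : LocallyPathConnectedSpace X := by
    refine ⟨fun x => Filter.hasBasis_self.2 fun W hW => ?_⟩
    obtain ⟨V, hVW, hV, hxV⟩ := mem_nhds_iff.1 hW
    obtain ⟨c, hc, rfl, hcV⟩ := h.exists_chart hV hxV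
    exact ⟨Set.range c, hc.isOpen_range.mem_nhds ⟨0, rfl⟩, isPathConnected_range hc.continuous,
      hcV.trans hVW⟩
  exact pathConnectedSpace_iff_connectedSpace.2 inferInstance

theorem pathConnectedSpace_prod_compl_singleton {X S : Type*} [TopologicalSpace X]
    [TopologicalSpace S] [PathConnectedSpace X] [PathConnectedSpace S] (a : X) {b b' : S}
    (hb : b' ≠ b) [PathConnectedSpace ({b}ᶜ : Set S)] :
    PathConnectedSpace ({(a, b)}ᶜ : Set (X × S)) := by
  let j : X × ({b}ᶜ : Set S) → ({(a, b)}ᶜ : Set (X × S)) := fun q =>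
    ⟨(q.1, q.2), fun h => q.2.2 (congrArg Prod.snd h)⟩
  have hj : Continuous j := by fun_prop
  have hjoin : ∀ p : ({(a, b)}ᶜ : Set (X × S)), ∃ q, Joined (j q) p := by
    rintro ⟨⟨x, y⟩, hp⟩
    by_cases hy : y = b
    · have hx : x ≠ a := by
        rintro rfl
        exact hp (by rw [hy]; rfl)
      let i : S → ({(a, b)}ᶜ : Set (X × S)) := fun s => ⟨(x, s), fun h =>
        hx (congrArg Prod.fst h)⟩
      have hi : Continuous i := by fun_prop
      exact ⟨(x, ⟨b', hb⟩), ⟨(PathConnectedSpace.somePath b' y).map hi⟩⟩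
    · exact ⟨(x, ⟨y, hy⟩), .refl _⟩
  refine ⟨⟨j (a, ⟨b', hb⟩)⟩, fun p p' => ?_⟩
  obtain ⟨q, hq⟩ := hjoin p
  obtain ⟨q', hq'⟩ := hjoin p'
  exact hq.symm.trans (Joined.trans ⟨(PathConnectedSpace.somePath q q').map hj⟩ hq')

theorem ConnectedSumData.isPathConnected {n : ℕ} {N M₁ M₂ : Type} [TopologicalSpace N]
    [TopologicalSpace M₁] [TopologicalSpace M₂] [T2Space M₁] (D : ConnectedSumData n N M₁ M₂)
    [PathConnectedSpace ({D.φ₁ 0}ᶜ : Set M₁)] : IsPathConnected D.C₁ := by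
  obtain ⟨κ, q, -, hq⟩ := D.exists_retraction
  rw [isPathConnected_iff_pathConnectedSpace]
  exact Function.Surjective.pathConnectedSpace (fun x => ⟨κ x, hq x⟩) q.continuous

/-- The boundary sphere along which the two pieces of a connected sum meet. -/
theorem ConnectedSumData.exists_isEmbedding_sphere {n : ℕ} {N M₁ M₂ : Type} [TopologicalSpace N]
    [TopologicalSpace M₁] [TopologicalSpace M₂] (D : ConnectedSumData n N M₁ M₂) :
    ∃ k : Metric.sphere (0 : EuclideanSpace ℝ (Fin n)) 1 → N, IsEmbedding k ∧
      Set.range k = D.C₁ ∩ D.C₂ := by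
  have hmem : ∀ w ∈ Metric.sphere (0 : EuclideanSpace ℝ (Fin n)) 1,
      D.φ₁ w ∈ (D.φ₁ '' Metric.ball 0 1)ᶜ := by
    rintro w hw ⟨u, hu, huw⟩
    obtain rfl := D.emb₁.injective huw
    rw [mem_sphere_zero_iff_norm] at hw
    rw [mem_ball_zero_iff, hw] at hu
    exact lt_irrefl _ hu
  let i : Metric.sphere (0 : EuclideanSpace ℝ (Fin n)) 1 → ((D.φ₁ '' Metric.ball 0 1)ᶜ : Set M₁) :=
    fun w => ⟨D.φ₁ w, hmem w w.2⟩
  have hi : IsEmbedding i := by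
    have : IsEmbedding (Subtype.val ∘ i) := D.emb₁.isEmbedding.comp .subtypeVal
    exact .of_comp (by have := D.emb₁.continuous; fun_prop) continuous_subtype_val this
  refine ⟨fun w => D.h₁.symm (i w), IsEmbedding.subtypeVal.comp (D.h₁.symm.isEmbedding.comp hi), ?_⟩
  ext x
  constructor
  · rintro ⟨w, rfl⟩
    refine ⟨(D.h₁.symm (i w)).2, (D.inter₁ _).2 ?_⟩
    rw [D.h₁.apply_symm_apply]
    exact ⟨w, w.2, rfl⟩
  · rintro ⟨hx, hx'⟩
    obtain ⟨w, hw, hwx⟩ := (D.inter₁ ⟨x, hx⟩).1 hx'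
    refine ⟨⟨w, hw⟩, ?_⟩
    have : D.h₁.symm (i ⟨w, hw⟩) = ⟨x, hx⟩ := by
      rw [Homeomorph.symm_apply_eq]
      exact Subtype.ext hwx
    exact congrArg Subtype.val this

theorem pathConnectedSpace_sphere (n : ℕ) :
    PathConnectedSpace (Metric.sphere (0 : EuclideanSpace ℝ (Fin (n + 2))) 1) := by
  rw [← isPathConnected_iff_pathConnectedSpace]
  refine isPathConnected_sphere ?_ 0 zero_le_one
  rw [← Module.finrank_eq_rank, finrank_euclideanSpace_fin]
  exact_mod_cast (by omega : 1 < n + 2)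

/-- Each summand `Σ × S²` of a connected sum carries a collared filtration. -/
theorem ConnectedSumData.nonempty_collaredFiltration_surface_prod {n : ℕ} {X N M₂ : Type}
    [TopologicalSpace X] [CompactSpace X] [TopologicalSpace.MetrizableSpace X]
    (hX : IsLocallyEuclidean 2 X) [TopologicalSpace N] [TopologicalSpace M₂]
    (D : ConnectedSumData n N (X × Metric.sphere (0 : EuclideanSpace ℝ (Fin 3)) 1) M₂) :
    Nonempty (CollaredFiltration D.C₁ D.C₂) := by
  obtain ⟨⟨a, b⟩, hab⟩ : ∃ p, D.φ₁ 0 = p := ⟨_, rfl⟩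
  obtain ⟨c, hc, hca, -⟩ := hX.exists_chart isOpen_univ (Set.mem_univ a)
  obtain ⟨ρ, A₀, A₁, V₂, hρ, hA₀, hA₁, hV₂, hdisj, hcompl, hVD, hcat⟩ :=
    exists_surface_decomposition hX hc
  subst hca
  have hcl : closure (c '' Metric.ball 0 ρ) ⊆ c '' Metric.closedBall 0 ρ :=
    closure_minimal (Set.image_mono Metric.ball_subset_closedBall)
      ((isCompact_closedBall _ _).image hc.continuous).isClosed
  have hne : ((c '' Metric.ball 0 ρ)ᶜ).Nonempty := by
    obtain ⟨u, hu⟩ := exists_norm_eq (EuclideanSpace ℝ (Fin 2)) hρ.le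
    refine ⟨c u, ?_⟩
    rw [Set.mem_compl_iff, hc.injective.mem_set_image, mem_ball_zero_iff, hu]
    exact lt_irrefl ρ
  have := contractibleSpace_sphere_compl_singleton b
  have := contractibleSpace_sphere_compl_singleton (-b)
  have hbb' : b ≠ -b := ne_neg_of_mem_unit_sphere ℝ b
  have : PathConnectedSpace (Metric.sphere (0 : EuclideanSpace ℝ (Fin 3)) 1) :=
    pathConnectedSpace_sphere 1
  have : Nontrivial (Metric.sphere (0 : EuclideanSpace ℝ (Fin 3)) 1) := ⟨b, -b, hbb'⟩
  have : Infinite (Metric.sphere (0 : EuclideanSpace ℝ (Fin 3)) 1) := PreconnectedSpace.infinite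
  obtain ⟨y₀, hy₀⟩ := ((Set.toFinite {-b, b}).infinite_compl).nonempty
  have hfil := exists_isCategoricalFiltration_punctured
    (a := c 0) hc hbb' ⟨y₀, by simpa using hy₀⟩ hA₀ hA₁ hV₂ (hc.isOpenMap _ Metric.isOpen_ball)
    ⟨0, by simpa using hρ, rfl⟩ hne hdisj hcompl
    (hVD.mono_right (Set.image_mono Metric.ball_subset_closedBall))
    (hcl.trans (Set.image_subset_range _ _)) (hcat _ (by simp)) (hcat _ (by simp))
    (hcat _ (by simp))
  rw [← hab] at hfil
  obtain ⟨F₀, F₁, F₂, hF, O, hO, habO, hFO⟩ := hfil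
  exact D.nonempty_collaredFiltration hF hO habO hFO

theorem ConnectedSumData.metrizableSpace {n : ℕ} {N M₁ M₂ : Type} [TopologicalSpace N]
    [TopologicalSpace M₁] [TopologicalSpace M₂] [CompactSpace M₁] [CompactSpace M₂] [T2Space M₁]
    [T2Space M₂] [SecondCountableTopology M₁] [SecondCountableTopology M₂]
    (D : ConnectedSumData n N M₁ M₂) (c₁ : CollaredFiltration D.C₁ D.C₂)
    (c₂ : CollaredFiltration D.C₂ D.C₁) :
    TopologicalSpace.MetrizableSpace N := by
  have key : ∀ {C : Set N} {M : Type} [TopologicalSpace M] [CompactSpace M] [T2Space M]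
      [SecondCountableTopology M] {φ : EuclideanSpace ℝ (Fin n) → M}, IsOpenEmbedding φ →
      C ≃ₜ ((φ '' Metric.ball 0 1)ᶜ : Set M) →
      CompactSpace C ∧ T2Space C ∧ SecondCountableTopology C := by
    intro C M _ _ _ _ φ hφ h
    have hcl : IsClosed (φ '' Metric.ball 0 1)ᶜ :=
      (hφ.isOpenMap _ Metric.isOpen_ball).isClosed_compl
    have := isCompact_iff_compactSpace.1 hcl.isCompact
    exact ⟨h.symm.compactSpace, h.isEmbedding.t2Space, h.secondCountableTopology⟩
  obtain ⟨_, _, _⟩ := key D.emb₁ D.h₁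
  obtain ⟨_, _, _⟩ := key D.emb₂ D.h₂
  obtain ⟨t, -, -, ht₁, ht₂⟩ := c₁.exists_signed c₂ D.closed₁ D.closed₂ D.cover
  exact metrizableSpace_of_closed_cover D.closed₁ D.closed₂ D.cover t ht₁ ht₂

theorem tcCoverable_connectedSum_surface_prod {X N : Type} [TopologicalSpace X] [CompactSpace X]
    [T2Space X] [SecondCountableTopology X] [ConnectedSpace X] (hX : IsLocallyEuclidean 2 X)
    [TopologicalSpace N]
    (D : ConnectedSumData 4 N (X × Metric.sphere (0 : EuclideanSpace ℝ (Fin 3)) 1)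
      (X × Metric.sphere (0 : EuclideanSpace ℝ (Fin 3)) 1)) :
    TCCoverable N 7 := by
  obtain ⟨c₁⟩ := D.nonempty_collaredFiltration_surface_prod hX
  obtain ⟨c₂⟩ := D.symm.nonempty_collaredFiltration_surface_prod hX
  obtain ⟨k, hk, hkC⟩ := D.exists_isEmbedding_sphere
  obtain ⟨v⟩ := (pathConnectedSpace_sphere 2).nonempty
  have := contractibleSpace_sphere_compl_singleton v
  have := contractibleSpace_sphere_compl_singleton (-v)
  obtain ⟨F₀, F₁, F₂, hF⟩ := c₁.exists_isCategoricalFiltration c₂ D.closed₁ D.closed₂ D.cover hk hkC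
    (ne_neg_of_mem_unit_sphere ℝ v)
  have := D.metrizableSpace c₁ c₂
  have : PathConnectedSpace X := hX.pathConnectedSpace
  have : PathConnectedSpace (Metric.sphere (0 : EuclideanSpace ℝ (Fin 3)) 1) :=
    pathConnectedSpace_sphere 1
  have hP : ∀ p : X × Metric.sphere (0 : EuclideanSpace ℝ (Fin 3)) 1,
      PathConnectedSpace ({p}ᶜ : Set (X × Metric.sphere (0 : EuclideanSpace ℝ (Fin 3)) 1)) := by
    rintro ⟨a, b⟩
    have := contractibleSpace_sphere_compl_singleton b
    exact pathConnectedSpace_prod_compl_singleton a (ne_neg_of_mem_unit_sphere ℝ b).symm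
  have := hP (D.φ₁ 0)
  have := hP (D.symm.φ₁ 0)
  have : PathConnectedSpace N := by
    rw [pathConnectedSpace_iff_univ, ← D.cover]
    exact D.isPathConnected.union D.symm.isPathConnected ⟨k v, hkC ▸ ⟨v, rfl⟩⟩
  exact hF.tcCoverable

/-- **Example.**  Let `Σ_g` be a closed oriented surface of genus `g ≥ 1` (equivalently,
a closed oriented aspherical surface).  Then `TC((Σ_g × S²) # (Σ_g × S²)) ≤ 7`. -/
theorem tc_connectedSum_surface_times_two_sphere_le
    (Sg : Type) [TopologicalSpace Sg]
    (hSg : IsClosedOrientedManifold 2 Sg) (haSg : Aspherical Sg)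
    (N : Type) [TopologicalSpace N]
    (hN : IsConnectedSum 4 N (Sg × unitSphere 2) (Sg × unitSphere 2)) :
    topologicalComplexity N ≤ 7 := by
  obtain ⟨_, _, _, _, hloc, -⟩ := hSg
  obtain ⟨D⟩ := hN
  exact sInf_le ⟨7, rfl, tcCoverable_connectedSum_surface_prod hloc D⟩

end
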